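/- Assume n > 2k + 8 + 4σ/k and q ≥ q_JL(k,σ). Then the extremal parameter equals λ* = λ̃(k,σ) := c_{n,k} τ_σ^k (n - 2k - k τ_σ) with τ_σ = (2k+σ)/(q-k), and for every λ ∈ (0, λ*) the radial problem (P_λ) admits exactly one classical radial solution. -/

import Mathlib

open Real Set Filter MeasureTheory

noncomputable section

/-- `c_{n,k} = (1/n) * binom(n,k)`. -/
def cnk (n k : ℕ) : ℝ := (n.choose k : ℝ) / n

/-- The critical exponent `q*(k,σ) = ((n+2)k + σ(k+1))/(n-2k)`. -/
def qstar (n k : ℕ) (σ : ℝ) : ℝ :=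
  (((n : ℝ) + 2) * k + σ * ((k : ℝ) + 1)) / ((n : ℝ) - 2 * k)

/-- The Joseph–Lundgren type exponent `q_JL(k,σ)` (finite formula, valid
for `n > 2k + 8 + 4σ/k`). -/
def qJL (n k : ℕ) (σ : ℝ) : ℝ :=
  (k : ℝ) *
    (((k : ℝ) * ((k : ℝ) + 1) * n - (k : ℝ) ^ 2 * (2 - σ) + 2 * k + σ -
        2 * Real.sqrt ((k : ℝ) * (2 * k + σ) * (((k : ℝ) + 1) * n - (k : ℝ) * (2 - σ)))) /
      ((k : ℝ) * ((k : ℝ) + 1) * n - 2 * (k : ℝ) ^ 2 * ((k : ℝ) + 3) - 2 * k * σ -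
        2 * Real.sqrt ((k : ℝ) * (2 * k + σ) * (((k : ℝ) + 1) * n - (k : ℝ) * (2 - σ)))))

/-- `λ̃(k,σ) = c_{n,k} τ_σ^k (n - 2k - k τ_σ)` with `τ_σ = (2k+σ)/(q-k)`. -/
def lamTilde (n k : ℕ) (q σ : ℝ) : ℝ :=
  cnk n k * ((2 * (k : ℝ) + σ) / (q - k)) ^ k *
    ((n : ℝ) - 2 * k - (k : ℝ) * ((2 * (k : ℝ) + σ) / (q - k)))

/-- `μ*(k,σ) = binom(n,k) ((n+σ)/n) (n-2k)^k / (k+1)^{k+1}`. -/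
def muStar (n k : ℕ) (σ : ℝ) : ℝ :=
  (n.choose k : ℝ) * (((n : ℝ) + σ) / n) * ((n : ℝ) - 2 * k) ^ k / ((k : ℝ) + 1) ^ (k + 1)

/-- A classical radial solution of problem `(P_λ)`:
`u ∈ C²((0,1)) ∩ C¹([0,1])`, `u'(0) = 0`, `u(1) = 0`, `u < 0` on `(0,1)`,
`(r^{n-i} (u')^i)' ≥ 0` on `(0,1)` for `i = 1,…,k`, and
`c_{n,k} r^{1-n} (r^{n-k}(u')^k)' = λ r^σ (1-u)^q` on `(0,1)`. -/
def IsRadialSol (n k : ℕ) (q σ lam : ℝ) (u : ℝ → ℝ) : Prop :=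
  ContDiffOn ℝ 2 u (Ioo 0 1) ∧ ContDiffOn ℝ 1 u (Icc 0 1) ∧
  deriv u 0 = 0 ∧ u 1 = 0 ∧
  (∀ r ∈ Ioo (0:ℝ) 1, u r < 0) ∧
  (∀ i : ℕ, 1 ≤ i → i ≤ k →
    ∀ r ∈ Ioo (0:ℝ) 1, 0 ≤ deriv (fun s => s ^ ((n : ℝ) - i) * (deriv u s) ^ i) r) ∧
  (∀ r ∈ Ioo (0:ℝ) 1,
    cnk n k * r ^ (1 - (n : ℝ)) *
        deriv (fun s => s ^ ((n : ℝ) - k) * (deriv u s) ^ k) r =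
      lam * r ^ σ * (1 - u r) ^ q)

/-- A radial subsolution of `(P_λ)`. -/
def IsRadialSubsol (n k : ℕ) (q σ lam : ℝ) (u : ℝ → ℝ) : Prop :=
  ContDiffOn ℝ 2 u (Ioo 0 1) ∧ ContDiffOn ℝ 1 u (Icc 0 1) ∧
  (∀ i : ℕ, 1 ≤ i → i ≤ k →
    ∀ r ∈ Ioo (0:ℝ) 1, 0 ≤ deriv (fun s => s ^ ((n : ℝ) - i) * (deriv u s) ^ i) r) ∧
  (∀ r ∈ Ioo (0:ℝ) 1,
    lam * r ^ σ * (1 - u r) ^ q ≤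
      cnk n k * r ^ (1 - (n : ℝ)) *
        deriv (fun s => s ^ ((n : ℝ) - k) * (deriv u s) ^ k) r) ∧
  u 1 ≤ 0


structure Sol (k N : ℕ) (q σ L : ℝ) (w v : ℝ → ℝ) : Prop where
  cont : ContinuousOn w (Icc 0 1)
  pos : ∀ r ∈ Icc (0:ℝ) 1, 0 < w r
  der : ∀ r ∈ Ioo (0:ℝ) 1, HasDerivAt w (-(v r)) r
  vdiff : ∀ r ∈ Ioo (0:ℝ) 1, DifferentiableAt ℝ v r
  vnn : ∀ r ∈ Ioo (0:ℝ) 1, 0 ≤ v r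
  vbd : ∃ M, ∀ r ∈ Ioo (0:ℝ) 1, v r ≤ M
  ode : ∀ r ∈ Ioo (0:ℝ) 1, HasDerivAt (fun s => s ^ N * v s ^ k)
    (L * r ^ ((N:ℝ) + k + σ - 1) * w r ^ q) r

/-- a function vanishing at zero with nonnegative derivative is nonnegative -/
lemma nonneg_of_deriv (G g : ℝ → ℝ) (hG : ∀ r ∈ Ioo (0:ℝ) 1, HasDerivAt G (g r) r)
    (hg : ∀ r ∈ Ioo (0:ℝ) 1, 0 ≤ g r) (h0 : Tendsto G (nhdsWithin 0 (Ioi 0)) (nhds 0)) :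
    ∀ r ∈ Ioo (0:ℝ) 1, 0 ≤ G r := by
  have hmono : MonotoneOn G (Ioo 0 1) := by
    apply monotoneOn_of_deriv_nonneg (convex_Ioo 0 1)
    · exact fun r hr => (hG r hr).continuousAt.continuousWithinAt
    · rw [interior_Ioo]; exact fun r hr => (hG r hr).differentiableAt.differentiableWithinAt
    · rw [interior_Ioo]; intro r hr; rw [(hG r hr).deriv]; exact hg r hr
  intro r hr
  apply le_of_tendsto h0
  filter_upwards [Ioo_mem_nhdsGT hr.1] with s hs
  exact hmono ⟨hs.1, hs.2.trans hr.2⟩ hr hs.2.le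

lemma tend_zero (k N : ℕ) (hN : 0 < N) (v : ℝ → ℝ) (hv : ∀ r ∈ Ioo (0:ℝ) 1, 0 ≤ v r)
    (M : ℝ) (hM : ∀ r ∈ Ioo (0:ℝ) 1, v r ≤ M) :
    Tendsto (fun s => s ^ N * v s ^ k) (nhdsWithin 0 (Ioi 0)) (nhds 0) := by
  have h1 : Tendsto (fun s : ℝ => s ^ N * M ^ k) (nhdsWithin 0 (Ioi 0)) (nhds 0) := by
    have : Continuous (fun s : ℝ => s ^ N * M ^ k) := by fun_prop
    have h := (this.tendsto 0).mono_left (nhdsWithin_le_nhds (s := Ioi (0:ℝ)))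
    simpa [hN.ne'] using h
  refine squeeze_zero' ?_ ?_ h1
  · filter_upwards [Ioo_mem_nhdsGT (zero_lt_one' ℝ)] with s hs
    have := hv s hs; have := hs.1; positivity
  · filter_upwards [Ioo_mem_nhdsGT (zero_lt_one' ℝ)] with s hs
    have h2 := hv s hs; have h3 := hM s hs; have := hs.1
    gcongr

lemma compare (k N : ℕ) (hk : 1 ≤ k) (hN : 0 < N) (v1 v2 g1 g2 : ℝ → ℝ)
    (hv1 : ∀ r ∈ Ioo (0:ℝ) 1, 0 ≤ v1 r) (hv2 : ∀ r ∈ Ioo (0:ℝ) 1, 0 ≤ v2 r)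
    (hM1 : ∃ M, ∀ r ∈ Ioo (0:ℝ) 1, v1 r ≤ M) (hM2 : ∃ M, ∀ r ∈ Ioo (0:ℝ) 1, v2 r ≤ M)
    (h1 : ∀ r ∈ Ioo (0:ℝ) 1, HasDerivAt (fun s => s ^ N * v1 s ^ k) (g1 r) r)
    (h2 : ∀ r ∈ Ioo (0:ℝ) 1, HasDerivAt (fun s => s ^ N * v2 s ^ k) (g2 r) r)
    (hg : ∀ r ∈ Ioo (0:ℝ) 1, g2 r ≤ g1 r) :
    ∀ r ∈ Ioo (0:ℝ) 1, v2 r ≤ v1 r := by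
  obtain ⟨M1, hM1⟩ := hM1
  obtain ⟨M2, hM2⟩ := hM2
  intro r hr
  have := nonneg_of_deriv (fun s => s ^ N * v1 s ^ k - s ^ N * v2 s ^ k) (fun r => g1 r - g2 r)
    (fun r hr => (h1 r hr).sub (h2 r hr)) (fun r hr => sub_nonneg.2 (hg r hr))
    (by simpa using (tend_zero k N hN v1 hv1 M1 hM1).sub (tend_zero k N hN v2 hv2 M2 hM2)) r hr
  have hr0 := hr.1
  have h3 : v2 r ^ k ≤ v1 r ^ k := by
    have h4 : r ^ N * v2 r ^ k ≤ r ^ N * v1 r ^ k := by linarith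
    exact le_of_mul_le_mul_left h4 (by positivity)
  exact (pow_le_pow_iff_left₀ (hv2 r hr) (hv1 r hr) (by omega)).1 h3

/-- lower bound of the flux -/
lemma flux (k N : ℕ) (hN : 0 < N) (q σ L : ℝ) (hq : 0 < q) (hσ : 0 ≤ σ) (hL : 0 < L)
    (w v : ℝ → ℝ) (h : Sol k N q σ L w v) :
    ∀ r ∈ Ioo (0:ℝ) 1, L * r ^ ((N:ℝ) + k + σ) * w r ^ q ≤ ((N:ℝ) + k + σ) * (r ^ N * v r ^ k) := by
  intro r hr
  have hN' : (0:ℝ) < N := by exact_mod_cast hN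
  have hE : 0 < (N:ℝ) + k + σ := by positivity
  set E := (N:ℝ) + k + σ with hEdef
  obtain ⟨M, hM⟩ := h.vbd
  have key := nonneg_of_deriv (fun s => E * (s ^ N * v s ^ k) - L * s ^ E * w s ^ q)
    (fun s => E * (L * s ^ (E - 1) * w s ^ q) -
      (L * (E * s ^ (E - 1)) * w s ^ q + L * s ^ E * (-(v s) * q * w s ^ (q - 1))))
    (fun s hs => ((h.ode s hs).const_mul E).sub
      (((Real.hasDerivAt_rpow_const (Or.inl hs.1.ne')).const_mul L).mul
        ((h.der s hs).rpow_const (Or.inl (h.pos s ⟨hs.1.le, hs.2.le⟩).ne'))))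
    ?_ ?_ r hr
  · linarith
  · intro s hs
    have h1 := h.vnn s hs
    have h2 := h.pos s ⟨hs.1.le, hs.2.le⟩
    have h3 := hs.1
    have : 0 ≤ L * s ^ E * (v s * q * w s ^ (q - 1)) := by positivity
    nlinarith
  · have h1 := (tend_zero k N hN v h.vnn M hM).const_mul E
    have h2 : Tendsto (fun s => L * s ^ E * w s ^ q) (nhdsWithin 0 (Ioi 0)) (nhds 0) := by
      have hc : ContinuousWithinAt (fun s => L * s ^ E * w s ^ q) (Icc 0 1) 0 := by
        apply ContinuousWithinAt.mul
        · exact ((Real.continuous_rpow_const hE.le).const_mul L |>.continuousWithinAt)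
        · exact (h.cont 0 (by simp)).rpow_const (Or.inr hq.le)
      have := hc.tendsto.mono_left (nhdsWithin_le_of_mem (Icc_mem_nhdsGT (zero_lt_one' ℝ)) : nhdsWithin (0:ℝ) (Ioi 0) ≤ _)
      simpa [Real.zero_rpow hE.ne'] using this
    simpa using h1.sub h2

lemma vpos (k N : ℕ) (hk : 1 ≤ k) (hN : 0 < N) (q σ L : ℝ) (hq : 0 < q) (hσ : 0 ≤ σ) (hL : 0 < L)
    (w v : ℝ → ℝ) (h : Sol k N q σ L w v) : ∀ r ∈ Ioo (0:ℝ) 1, 0 < v r := by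
  intro r hr
  have h1 := flux k N hN q σ L hq hσ hL w v h r hr
  have h2 := h.pos r ⟨hr.1.le, hr.2.le⟩
  have h3 := hr.1
  have h4 : 0 < L * r ^ ((N:ℝ) + k + σ) * w r ^ q := by positivity
  rcases (h.vnn r hr).eq_or_lt with h5 | h5
  · rw [← h5, zero_pow (by omega)] at h1; simp at h1; linarith
  · exact h5

/-- scaling -/
lemma Sol.scale (k N : ℕ) (q σ L τ : ℝ) (hτ : τ * (q - k) = 2 * k + σ)
    (w v : ℝ → ℝ) (h : Sol k N q σ L w v) (b : ℝ) (hb : 0 < b) (hb1 : b ≤ 1) :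
    Sol k N q σ L (fun r => b ^ τ * w (b * r)) (fun r => b ^ (τ + 1) * v (b * r)) := by
  have hbt : 0 < b ^ τ := by positivity
  have hbt1 : 0 < b ^ (τ+1) := by positivity
  have hIoo : ∀ r ∈ Ioo (0:ℝ) 1, b * r ∈ Ioo (0:ℝ) 1 := by
    intro r hr; exact ⟨mul_pos hb hr.1, by nlinarith [hr.1, hr.2]⟩
  have hIcc : ∀ r ∈ Icc (0:ℝ) 1, b * r ∈ Icc (0:ℝ) 1 := by
    intro r hr; exact ⟨mul_nonneg hb.le hr.1, by nlinarith [hr.1, hr.2]⟩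
  have hd : ∀ r : ℝ, HasDerivAt (fun r => b * r) b r := fun r => by
    simpa using (hasDerivAt_id r).const_mul b
  refine ⟨?_, ?_, ?_, ?_, ?_, ?_, ?_⟩
  · exact (h.cont.comp (by fun_prop) hIcc).const_smul (b ^ τ)
  · intro r hr; exact mul_pos hbt (h.pos _ (hIcc r hr))
  · intro r hr
    have := ((h.der _ (hIoo r hr)).comp r (hd r)).const_mul (b ^ τ)
    refine HasDerivAt.congr_deriv this ?_
    rw [Real.rpow_add hb, Real.rpow_one]; ring
  · intro r hr
    exact ((h.vdiff _ (hIoo r hr)).comp r (hd r).differentiableAt).const_mul _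
  · intro r hr; exact mul_nonneg hbt1.le (h.vnn _ (hIoo r hr))
  · obtain ⟨M, hM⟩ := h.vbd
    exact ⟨b ^ (τ+1) * M, fun r hr => mul_le_mul_of_nonneg_left (hM _ (hIoo r hr)) hbt1.le⟩
  · intro r hr
    have := ((h.ode _ (hIoo r hr)).comp r (hd r)).const_mul ((b ^ (τ+1)) ^ k * (b ^ N)⁻¹)
    have e1 : (fun s => s ^ N * (b ^ (τ + 1) * v (b * s)) ^ k) =
        fun s => ((b ^ (τ+1)) ^ k * (b ^ N)⁻¹) * ((fun s => s ^ N * v s ^ k) ∘ fun r => b * r) s := by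
      funext s; simp only [Function.comp, mul_pow]; field_simp
    rw [e1]
    refine HasDerivAt.congr_deriv this ?_
    have hw := h.pos _ (hIcc r ⟨hr.1.le, hr.2.le⟩)
    rw [Real.mul_rpow hbt.le hw.le, Real.mul_rpow hb.le hr.1.le, ← Real.rpow_mul hb.le,
      ← Real.rpow_natCast (b ^ (τ+1)), ← Real.rpow_mul hb.le, ← Real.rpow_natCast b N,
      ← Real.rpow_neg hb.le]
    have e2 : b ^ (τ * q) = b ^ ((τ+1) * k) * b ^ (-(N:ℝ)) * b ^ ((N:ℝ) + k + σ - 1) * b ^ (1:ℝ) := by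
      rw [← Real.rpow_add hb, ← Real.rpow_add hb, ← Real.rpow_add hb]
      congr 1; linarith
    rw [e2, Real.rpow_one]; ring

set_option maxHeartbeats 1000000 in
lemma algebra_theta (n k q σ : ℝ) (hk : 1 ≤ k) (hq : k < q) (hσ : 0 ≤ σ)
    (hn : 2 * k + 8 + 4 * σ / k < n)
    (hJ : k * ((k * (k + 1) * n - k ^ 2 * (2 - σ) + 2 * k + σ -
        2 * Real.sqrt (k * (2 * k + σ) * ((k + 1) * n - k * (2 - σ)))) /
      (k * (k + 1) * n - 2 * k ^ 2 * (k + 3) - 2 * k * σ -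
        2 * Real.sqrt (k * (2 * k + σ) * ((k + 1) * n - k * (2 - σ))))) ≤ q) :
    0 < n - 2 * k - k * ((2 * k + σ) / (q - k)) ∧
    ∃ θ, q < θ ∧ θ * (θ - k) * ((2 * k + σ) / (q - k)) ≤
      (θ - q) * (k * (n - 2 * k - k * ((2 * k + σ) / (q - k)))) := by
  have hk0 : 0 < k := by linarith
  obtain ⟨y, hy⟩ : ∃ y, y = q - k := ⟨_, rfl⟩
  have hy0 : 0 < y := by linarith
  obtain ⟨S, hS⟩ : ∃ S, S = 2 * k + σ := ⟨_, rfl⟩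
  have hS0 : 0 < S := by linarith
  obtain ⟨a, ha⟩ : ∃ a, a = k * (n - 2 * k) / S - 2 := ⟨_, rfl⟩
  have hkn : k * n = S * (a + 2) + 2 * k ^ 2 := by rw [ha]; field_simp; ring
  have ha2 : 2 < a := by
    have h1 : 4 * σ / k * k = 4 * σ := by field_simp
    have h2 : 4 * S < k * (n - 2 * k) := by rw [hS]; nlinarith
    have : 4 < k * (n - 2 * k) / S := by rw [lt_div_iff₀ hS0]; linarith
    linarith
  obtain ⟨b, hb⟩ : ∃ b, b = (k + 1) * a := ⟨_, rfl⟩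
  have hbk : 2 * (k + 1) < b := by rw [hb]; nlinarith
  have hb0 : 0 < b := by linarith
  obtain ⟨R, hR⟩ : ∃ R, R = Real.sqrt (b + (k + 1) ^ 2 + 1) := ⟨_, rfl⟩
  have hR0 : 0 ≤ R := hR ▸ Real.sqrt_nonneg _
  have hR2 : R ^ 2 = b + (k + 1) ^ 2 + 1 := by rw [hR]; exact Real.sq_sqrt (by positivity)
  have hsq : Real.sqrt (k * (2 * k + σ) * ((k + 1) * n - k * (2 - σ))) = S * R := by
    have e : k * (2 * k + σ) * ((k + 1) * n - k * (2 - σ)) = S ^ 2 * (b + (k + 1) ^ 2 + 1) := by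
      have : k * (2 * k + σ) * ((k + 1) * n - k * (2 - σ)) =
        (2 * k + σ) * ((k + 1) * (k * n) - k ^ 2 * (2 - σ)) := by ring
      rw [this, hkn, hb, hS]; ring
    rw [e, Real.sqrt_mul (sq_nonneg S), Real.sqrt_sq hS0.le, hR]
  rw [hsq] at hJ
  have hden : k * (k + 1) * n - 2 * k ^ 2 * (k + 3) - 2 * k * σ - 2 * (S * R) = S * (b + 2 - 2 * R) := by
    have : k * (k + 1) * n = (k + 1) * (k * n) := by ring
    rw [this, hkn, hb, hS]; ring
  have hnum : k * (k + 1) * n - k ^ 2 * (2 - σ) + 2 * k + σ - 2 * (S * R) =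
      S * (b + 2 - 2 * R) + S * (k + 1) ^ 2 := by
    rw [← hden, hS]; ring
  rw [hden, hnum] at hJ
  have hDD : (b + 2 + 2 * R) * (b + 2 - 2 * R) = (k + 1) ^ 2 * (a ^ 2 - 4) := by
    have : (b + 2 + 2 * R) * (b + 2 - 2 * R) = (b + 2) ^ 2 - 4 * R ^ 2 := by ring
    rw [this, hR2, hb]; ring
  have ha4 : 0 < a ^ 2 - 4 := by nlinarith
  have hbR : 0 < b + 2 + 2 * R := by linarith
  have hD : 0 < b + 2 - 2 * R := by
    by_contra hc
    have h1 : 0 < (k + 1) ^ 2 * (a ^ 2 - 4) := by positivity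
    nlinarith
  have hyD : k * (k + 1) ^ 2 ≤ y * (b + 2 - 2 * R) := by
    have e : k * ((S * (b + 2 - 2 * R) + S * (k + 1) ^ 2) / (S * (b + 2 - 2 * R))) =
      k + k * (k + 1) ^ 2 / (b + 2 - 2 * R) := by field_simp
    rw [e] at hJ
    have : k * (k + 1) ^ 2 / (b + 2 - 2 * R) ≤ y := by linarith
    rwa [div_le_iff₀ hD] at this
  have hya : k * (b + 2 + 2 * R) ≤ y * (a ^ 2 - 4) := by
    have h1 : (k + 1) ^ 2 * (k * (b + 2 + 2 * R)) ≤ (k + 1) ^ 2 * (y * (a ^ 2 - 4)) := by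
      calc (k + 1) ^ 2 * (k * (b + 2 + 2 * R)) = k * (k + 1) ^ 2 * (b + 2 + 2 * R) := by ring
        _ ≤ y * (b + 2 - 2 * R) * (b + 2 + 2 * R) := mul_le_mul_of_nonneg_right hyD hbR.le
        _ = y * ((b + 2 + 2 * R) * (b + 2 - 2 * R)) := by ring
        _ = _ := by rw [hDD]; ring
    exact le_of_mul_le_mul_left h1 (by positivity)
  have hP : 0 ≤ (a ^ 2 - 4) * y ^ 2 - 2 * k * (b + 2) * y + k ^ 2 * (k + 1) ^ 2 := by
    have h1 : (a ^ 2 - 4) * ((a ^ 2 - 4) * y ^ 2 - 2 * k * (b + 2) * y + k ^ 2 * (k + 1) ^ 2) =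
      (y * (a ^ 2 - 4) - k * (b + 2)) ^ 2 - (k * (2 * R)) ^ 2 := by
      have : (k * (2 * R)) ^ 2 = 4 * k ^ 2 * R ^ 2 := by ring
      rw [this, hR2, hb]; ring
    have h2 : k * (2 * R) ≤ y * (a ^ 2 - 4) - k * (b + 2) := by linarith
    have h3 : (k * (2 * R)) ^ 2 ≤ (y * (a ^ 2 - 4) - k * (b + 2)) ^ 2 :=
      pow_le_pow_left₀ (by positivity) h2 2
    have h4 : 0 ≤ (a ^ 2 - 4) * ((a ^ 2 - 4) * y ^ 2 - 2 * k * (b + 2) * y + k ^ 2 * (k + 1) ^ 2) := by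
      rw [h1]; linarith
    exact nonneg_of_mul_nonneg_right h4 ha4
  have hay : k * (k + 1) < a * y := by
    have h1 : k * (b + 2) ≤ y * (a ^ 2 - 4) := by nlinarith
    have h2 : (a ^ 2 - 4) * (k * (k + 1)) < (a ^ 2 - 4) * (a * y) := by
      have : a * (k * (b + 2)) ≤ a * (y * (a ^ 2 - 4)) := by gcongr
      have h5 : a * (k * (b + 2)) = (a ^ 2 - 4) * (k * (k + 1)) + 4 * (k * (k + 1)) + 2 * a * k := by
        rw [hb]; ring
      have : 0 < 4 * (k * (k + 1)) + 2 * a * k := by positivity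
      nlinarith
    exact lt_of_mul_lt_mul_left h2 ha4.le
  obtain ⟨τ, hτ⟩ : ∃ τ, τ = (2 * k + σ) / (q - k) := ⟨_, rfl⟩
  have hτy : τ * y = S := by rw [hτ, hy, hS]; field_simp [sub_ne_zero.2 hq.ne']
  have hτ0 : 0 < τ := by rw [hτ, ← hS, ← hy]; positivity
  rw [← hτ]
  obtain ⟨A, hA⟩ : ∃ A, A = (a + 2) * y - k ^ 2 := ⟨_, rfl⟩
  have hm : k * (n - 2 * k - k * τ) = τ * A := by
    have : k * (n - 2 * k - k * τ) = k * n - 2 * k ^ 2 - k ^ 2 * τ := by ring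
    rw [this, hkn, ← hτy, hA]; ring
  have hAq : 2 * q - k < A := by
    have e : A - (2 * q - k) = a * y - k * (k + 1) := by rw [hA, hy]; ring
    linarith
  have hA0 : 0 < A := by linarith
  refine ⟨?_, (k + A) / 2, by linarith, ?_⟩
  · have : 0 < k * (n - 2 * k - k * τ) := by rw [hm]; positivity
    exact pos_of_mul_pos_right this hk0.le
  · rw [hm]
    have hdisc : 0 ≤ (k + A) ^ 2 - 4 * A * q := by
      have : (k + A) ^ 2 - 4 * A * q =
        (a ^ 2 - 4) * y ^ 2 - 2 * k * (b + 2) * y + k ^ 2 * (k + 1) ^ 2 := by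
        have : q = y + k := by linarith
        rw [hA, hb, this]; ring
      rw [this]; exact hP
    have e : ((k + A) / 2 - q) * (τ * A) - (k + A) / 2 * ((k + A) / 2 - k) * τ =
        τ * ((k + A) ^ 2 - 4 * A * q) / 4 := by ring
    have : 0 ≤ τ * ((k + A) ^ 2 - 4 * A * q) / 4 := by positivity
    linarith

/-- differential inequality -/
lemma pos_of_diff_ineq (f f' : ℝ → ℝ) (a b K : ℝ) (hab : a ≤ b)
    (hf : ∀ r ∈ Icc a b, HasDerivAt f (f' r) r) (hK : ∀ r ∈ Icc a b, -K * f r ≤ f' r)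
    (ha : 0 < f a) : 0 < f b := by
  have hd : ∀ r ∈ Icc a b, HasDerivAt (fun r => f r * Real.exp (K * r))
      (f' r * Real.exp (K * r) + f r * (Real.exp (K * r) * K)) r := by
    intro r hr
    have h1 : HasDerivAt (fun r => K * r) K r := by simpa using (hasDerivAt_id r).const_mul K
    exact (hf r hr).mul h1.exp
  have hmono : MonotoneOn (fun r => f r * Real.exp (K * r)) (Icc a b) := by
    apply monotoneOn_of_deriv_nonneg (convex_Icc a b)
    · exact fun r hr => (hd r hr).continuousAt.continuousWithinAt
    · intro r hr; exact (hd r (interior_subset hr)).differentiableAt.differentiableWithinAt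
    · intro r hr
      rw [(hd r (interior_subset hr)).deriv]
      have := hK r (interior_subset hr)
      have h2 := Real.exp_pos (K * r)
      nlinarith
  have := hmono ⟨le_refl a, hab⟩ ⟨hab, le_refl b⟩ hab
  simp only at this
  have h1 := mul_pos ha (Real.exp_pos (K * a))
  have h2 : 0 < f b * Real.exp (K * b) := by linarith
  exact pos_of_mul_pos_left h2 (Real.exp_pos _).le

/-- the barrier for the Lotka–Volterra system -/
lemma barrier (k n q σ τ θ ms : ℝ) (hk : 0 < k) (hq : k < q) (hθ : q < θ) (hτ : 0 < τ)
    (hτq : τ * (q - k) = 2 * k + σ) (hms : ms = n - 2 * k - k * τ)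
    (hJ : θ * (θ - k) * τ ≤ (θ - q) * (k * ms)) (p m : ℝ → ℝ)
    (hp : ∀ r ∈ Ioo (0:ℝ) 1, HasDerivAt p (p r * (p r + (m r - (n - 2 * k)) / k) / r) r)
    (hm : ∀ r ∈ Ioo (0:ℝ) 1, HasDerivAt m (m r * (n + σ - q * p r - m r) / r) r)
    (hp0 : ∀ r ∈ Ioo (0:ℝ) 1, 0 < p r)
    (hmb : ∀ r ∈ Ioo (0:ℝ) 1, m r ≤ n + σ)
    (hlim : Tendsto p (nhdsWithin 0 (Ioi 0)) (nhds 0)) :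
    ∀ r ∈ Ioo (0:ℝ) 1, p r < τ ∧ m r - ms < θ * (τ - p r) := by
  intro r1 hr1
  by_contra hbad
  -- starting point
  have hδ : 0 < τ * (θ - q) / θ := by
    apply div_pos (mul_pos hτ (by linarith)); linarith
  have hθ0 : 0 < θ := by linarith
  obtain ⟨e, he, hpe⟩ : ∃ e ∈ Ioo (0:ℝ) r1, p e < τ * (θ - q) / θ := by
    have h1 := hlim.eventually (gt_mem_nhds hδ)
    have h2 := h1.and (Ioo_mem_nhdsGT hr1.1)
    obtain ⟨e, he⟩ := h2.exists
    exact ⟨e, he.2, he.1⟩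
  rw [lt_div_iff₀ hθ0] at hpe
  have hsub : ∀ r, e ≤ r → r ≤ r1 → r ∈ Ioo (0:ℝ) 1 := fun r h1 h2 =>
    ⟨he.1.trans_le h1, h2.trans_lt hr1.2⟩
  let X : ℝ → ℝ := fun r => τ - p r
  let Z : ℝ → ℝ := fun r => θ * (τ - p r) - (m r - ms)
  have hX : ∀ r ∈ Ioo (0:ℝ) 1, HasDerivAt X (-(p r * (p r + (m r - (n - 2 * k)) / k) / r)) r :=
    fun r hr => by simpa using (hp r hr).const_sub τ
  have hZ : ∀ r ∈ Ioo (0:ℝ) 1, HasDerivAt Z (θ * (-(p r * (p r + (m r - (n - 2 * k)) / k) / r))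
      - m r * (n + σ - q * p r - m r) / r) r :=
    fun r hr => ((hX r hr).const_mul θ).sub ((hm r hr).sub_const ms)
  have hXe : 0 < X e := by
    have h1 := hp0 e (hsub e le_rfl he.2.le)
    show 0 < τ - p e
    nlinarith
  have hZe : 0 < Z e := by
    have h1 := hmb e (hsub e le_rfl he.2.le)
    show 0 < θ * (τ - p e) - (m e - ms)
    nlinarith
  -- first bad point
  let B : Set ℝ := {r | r ∈ Icc e r1 ∧ (X r ≤ 0 ∨ Z r ≤ 0)}
  have hXc : ContinuousOn X (Icc e r1) := fun r hr =>
    (hX r (hsub r hr.1 hr.2)).continuousAt.continuousWithinAt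
  have hZc : ContinuousOn Z (Icc e r1) := fun r hr =>
    (hZ r (hsub r hr.1 hr.2)).continuousAt.continuousWithinAt
  have hBne : B.Nonempty := by
    refine ⟨r1, ⟨he.2.le, le_rfl⟩, ?_⟩
    by_contra hc
    push Not at hc
    exact hbad ⟨by have := hc.1; simp only [X] at this; linarith, by have := hc.2; simp only [Z] at this; linarith⟩
  have hBcl : IsClosed B := by
    have h1 : IsClosed (Icc e r1 ∩ X ⁻¹' Iic 0) := hXc.preimage_isClosed_of_isClosed isClosed_Icc isClosed_Iic
    have h2 : IsClosed (Icc e r1 ∩ Z ⁻¹' Iic 0) := hZc.preimage_isClosed_of_isClosed isClosed_Icc isClosed_Iic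
    have : B = (Icc e r1 ∩ X ⁻¹' Iic 0) ∪ (Icc e r1 ∩ Z ⁻¹' Iic 0) := by
      ext r; simp only [B, mem_ofPred_eq, mem_union, mem_inter_iff, mem_preimage, mem_Iic]; tauto
    rw [this]; exact h1.union h2
  have hBbd : BddBelow B := ⟨e, fun r hr => hr.1.1⟩
  obtain ⟨r0, hr0⟩ : ∃ r0, r0 = sInf B := ⟨_, rfl⟩
  have hr0B : r0 ∈ B := hr0 ▸ hBcl.csInf_mem hBne hBbd
  have hlt : ∀ r, e ≤ r → r < r0 → 0 < X r ∧ 0 < Z r := by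
    intro r h1 h2
    by_contra hc
    have : r ∈ B := ⟨⟨h1, h2.le.trans hr0B.1.2⟩, by
      by_contra hd; push Not at hd; exact hc hd⟩
    have := csInf_le hBbd this
    linarith
  have her0 : e < r0 := by
    rcases hr0B.1.1.eq_or_lt with h | h
    · exfalso; rw [← h] at hr0B
      rcases hr0B.2 with h' | h' <;> linarith
    · exact h
  have hge : ∀ r ∈ Icc e r0, 0 ≤ X r ∧ 0 ≤ Z r := by
    intro r hr
    rcases hr.2.eq_or_lt with h | h
    · have hne : (nhdsWithin r0 (Ioo e r0)).NeBot := by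
        rw [← mem_closure_iff_nhdsWithin_neBot, closure_Ioo her0.ne]; exact ⟨her0.le, le_rfl⟩
      have h0 := hsub r0 hr0B.1.1 hr0B.1.2
      rw [h]
      constructor
      · refine ge_of_tendsto ((hX r0 h0).continuousAt.tendsto.mono_left (nhdsWithin_le_nhds (s := Ioo e r0))) ?_
        filter_upwards [self_mem_nhdsWithin] with s hs using (hlt s hs.1.le hs.2).1.le
      · refine ge_of_tendsto ((hZ r0 h0).continuousAt.tendsto.mono_left (nhdsWithin_le_nhds (s := Ioo e r0))) ?_
        filter_upwards [self_mem_nhdsWithin] with s hs using (hlt s hs.1.le hs.2).2.le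
    · exact ⟨(hlt r hr.1 h).1.le, (hlt r hr.1 h).2.le⟩
  have hsub' : ∀ r ∈ Icc e r0, r ∈ Ioo (0:ℝ) 1 := fun r hr => hsub r hr.1 (hr.2.trans hr0B.1.2)
  have hpc : ContinuousOn p (Icc e r0) := fun r hr => (hp r (hsub' r hr)).continuousAt.continuousWithinAt
  have hmc : ContinuousOn m (Icc e r0) := fun r hr => (hm r (hsub' r hr)).continuousAt.continuousWithinAt
  have hrne : ∀ r ∈ Icc e r0, r ≠ 0 := fun r hr => (hsub' r hr).1.ne'
  obtain ⟨K1, hK1⟩ := isCompact_Icc.exists_bound_of_continuousOn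
    (f := fun r => p r * (θ - k) / k / r) (s := Icc e r0) (by
      exact ((hpc.mul continuousOn_const).div_const k).div continuousOn_id hrne)
  obtain ⟨K2, hK2⟩ := isCompact_Icc.exists_bound_of_continuousOn
    (f := fun r => (θ * p r / k - m r - (θ - q) * (τ - p r)) / r) (s := Icc e r0) (by
      exact ((((continuousOn_const.mul hpc).div_const k).sub hmc).sub
        (continuousOn_const.mul (continuousOn_const.sub hpc))).div continuousOn_id hrne)
  have hXpos : 0 < X r0 := by
    refine pos_of_diff_ineq X _ e r0 K1 her0.le (fun r hr => hX r (hsub' r hr)) ?_ hXe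
    intro r hr
    have h1 := hK1 r hr
    rw [Real.norm_eq_abs] at h1
    have h2 := (le_abs_self _).trans h1
    have hX0 := (hge r hr).1
    have hZ0 := (hge r hr).2
    have hr' := (hsub' r hr).1
    have hp' := hp0 r (hsub' r hr)
    have e1 : -(p r * (p r + (m r - (n - 2 * k)) / k) / r) =
        p r / k * Z r / r - (p r * (θ - k) / k / r) * X r := by
      simp only [X, Z, hms]; field_simp; ring
    rw [e1]
    have h3 : 0 ≤ p r / k * Z r / r := by positivity
    have h4 := mul_le_mul_of_nonneg_right h2 hX0
    linarith
  have hZpos : 0 < Z r0 := by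
    refine pos_of_diff_ineq Z _ e r0 K2 her0.le (fun r hr => hZ r (hsub' r hr)) ?_ hZe
    intro r hr
    have h1 := hK2 r hr
    rw [Real.norm_eq_abs] at h1
    have h2 := (abs_le.1 h1).1
    have hX0 := (hge r hr).1
    have hZ0 := (hge r hr).2
    have hr' := (hsub' r hr).1
    have e1 : θ * (-(p r * (p r + (m r - (n - 2 * k)) / k) / r))
      - m r * (n + σ - q * p r - m r) / r =
        X r * (((θ - q) * (k * ms) - θ * (θ - k) * τ) / k + (θ - q) * θ * X r + θ * (θ - k) * X r / k) / r
         + ((θ * p r / k - m r - (θ - q) * (τ - p r)) / r) * Z r := by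
      have hσ : σ = τ * (q - k) - 2 * k := by linarith
      simp only [X, Z, hms, hσ]; field_simp; ring
    rw [e1]
    have h5 : 0 ≤ (θ - q) * (k * ms) - θ * (θ - k) * τ := by linarith
    have h6 : 0 ≤ θ - q := by linarith
    have h7 : 0 ≤ θ - k := by linarith
    have h3 : 0 ≤ X r * (((θ - q) * (k * ms) - θ * (θ - k) * τ) / k + (θ - q) * θ * X r + θ * (θ - k) * X r / k) / r := by
      positivity
    have h4 := mul_le_mul_of_nonneg_right h2 hZ0
    linarith
  rcases hr0B.2 with h | h <;> linarith

lemma sol_pm (k N : ℕ) (hk : 1 ≤ k) (hN : 0 < N) (q σ L : ℝ) (hq : 0 < q)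
    (hσ : 0 ≤ σ) (hL : 0 < L) (w v : ℝ → ℝ) (h : Sol k N q σ L w v) (r : ℝ) (hr : r ∈ Ioo (0:ℝ) 1) :
    HasDerivAt (fun r => r * v r / w r) ((r * v r / w r) * ((r * v r / w r) +
      (L * r ^ ((N:ℝ) + k + σ) * w r ^ q / (r ^ N * v r ^ k) - (((N:ℝ) + k) - 2 * k)) / k) / r) r ∧
    HasDerivAt (fun r => L * r ^ ((N:ℝ) + k + σ) * w r ^ q / (r ^ N * v r ^ k))
      ((L * r ^ ((N:ℝ) + k + σ) * w r ^ q / (r ^ N * v r ^ k)) * (((N:ℝ) + k) + σ -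
        q * (r * v r / w r) - L * r ^ ((N:ℝ) + k + σ) * w r ^ q / (r ^ N * v r ^ k)) / r) r := by
  have hr0 := hr.1
  have hv := vpos k N hk hN q σ L hq hσ hL w v h r hr
  have hw := h.pos r ⟨hr.1.le, hr.2.le⟩
  have hkR : (0:ℝ) < k := by exact_mod_cast hk
  obtain ⟨E, hE⟩ : ∃ E, E = (N:ℝ) + k + σ := ⟨_, rfl⟩
  have hode := h.ode r hr
  rw [← hE] at hode ⊢
  have hdv := (h.vdiff r hr).hasDerivAt
  obtain ⟨dv, hdve⟩ : ∃ d, d = deriv v r := ⟨_, rfl⟩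
  rw [← hdve] at hdv
  have hJ : 0 < r ^ N * v r ^ k := by positivity
  have hEr : r ^ (E - 1) = r ^ E / r := Real.rpow_sub_one hr0.ne' E
  have hwq : w r ^ (q - 1) = w r ^ q / w r := Real.rpow_sub_one hw.ne' q
  constructor
  · obtain ⟨m, hm⟩ : ∃ m, m = L * r ^ E * w r ^ q / (r ^ N * v r ^ k) := ⟨_, rfl⟩
    have hmJ : m * (r ^ N * v r ^ k) = L * r ^ E * w r ^ q := by rw [hm]; field_simp
    rw [← hm]
    have h1 := (((hasDerivAt_id r).pow N).mul (hdv.pow k)).unique hode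
    simp only [id, Pi.pow_apply] at h1
    have hrN : r ^ (N - 1) * r = r ^ N := pow_sub_one_mul (by omega) r
    have hvk : v r ^ (k - 1) * v r = v r ^ k := pow_sub_one_mul (by omega) _
    have h2 : (m - N) * v r = k * r * dv := by
      rw [hEr] at h1
      have h3 : (m - N) * (r ^ N * v r ^ k) = r * (r ^ N * (k * v r ^ (k-1) * dv)) := by
        have h4 : L * (r ^ E / r) * w r ^ q * r = L * r ^ E * w r ^ q := by field_simp
        rw [sub_mul, hmJ, ← h4, ← h1, ← hrN]; ring
      have h5 : (r ^ N * v r ^ (k-1)) * ((m - N) * v r) = (r ^ N * v r ^ (k-1)) * (k * r * dv) := by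
        calc _ = (m - N) * (r ^ N * (v r ^ (k-1) * v r)) := by ring
          _ = _ := by rw [hvk, h3]; ring
      exact mul_left_cancel₀ (by positivity) h5
    have h6 : dv = (m - N) * v r / (k * r) := by rw [h2]; field_simp
    refine HasDerivAt.congr_deriv (((hasDerivAt_id r).mul hdv).div (h.der r hr) hw.ne') ?_
    simp only [id, Pi.mul_apply]
    rw [h6]; field_simp; ring
  · refine HasDerivAt.congr_deriv ((((Real.hasDerivAt_rpow_const (p := E) (Or.inl hr0.ne')).const_mul L).mul
        ((h.der r hr).rpow_const (p := q) (Or.inl hw.ne'))).div hode hJ.ne') ?_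
    simp only [Pi.mul_apply]
    rw [hEr, hwq]
    field_simp
    ring

lemma sol_barrier (k N : ℕ) (hk : 1 ≤ k) (hN : 0 < N) (q σ L τ θ ms : ℝ) (hq : k < q)
    (hσ : 0 ≤ σ) (hL : 0 < L) (hτ : 0 < τ) (hτq : τ * (q - k) = 2 * k + σ)
    (hθ : q < θ) (hms : ms = ((N:ℝ) + k) - 2 * k - k * τ)
    (hJ : θ * (θ - k) * τ ≤ (θ - q) * (k * ms)) 
    (w v : ℝ → ℝ) (h : Sol k N q σ L w v) (r : ℝ) (hr : r ∈ Ioo (0:ℝ) 1) :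
    r * v r / w r < τ ∧ L * r ^ ((N:ℝ) + k + σ) * w r ^ q / (r ^ N * v r ^ k) - ms <
      θ * (τ - r * v r / w r) := by
  have hkR : (0:ℝ) < k := by exact_mod_cast hk
  have hq0 : 0 < q := by linarith
  have hv := vpos k N hk hN q σ L hq0 hσ hL w v h
  refine barrier k ((N:ℝ) + k) q σ τ θ ms hkR hq hθ hτ hτq hms hJ (fun r => r * v r / w r)
    (fun r => L * r ^ ((N:ℝ) + k + σ) * w r ^ q / (r ^ N * v r ^ k))
    (fun r hr => (sol_pm k N hk hN q σ L hq0 hσ hL w v h r hr).1)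
    (fun r hr => (sol_pm k N hk hN q σ L hq0 hσ hL w v h r hr).2) ?_ ?_ ?_ r hr
  · intro r hr
    have := hr.1; have := hv r hr; have := h.pos r ⟨hr.1.le, hr.2.le⟩
    positivity
  · intro r hr
    have h1 := hr.1; have h2 := hv r hr
    have := flux k N hN q σ L hq0 hσ hL w v h r hr
    rw [div_le_iff₀ (by positivity)]
    exact this
  · obtain ⟨M, hM⟩ := h.vbd
    have hc := (h.cont 0 (by simp)).tendsto.mono_left 
      (nhdsWithin_le_of_mem (Icc_mem_nhdsGT (zero_lt_one' ℝ)) : nhdsWithin (0:ℝ) (Ioi 0) ≤ _)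
    have h1 := tend_zero 1 1 one_pos v h.vnn M hM
    simp only [pow_one] at h1
    have h2 := h1.div hc (h.pos 0 (by simp)).ne'
    rw [zero_div] at h2
    exact h2

lemma sol_bound (k N : ℕ) (hk : 1 ≤ k) (hN : 0 < N) (q σ L τ θ ms : ℝ) (hq : k < q)
    (hσ : 0 ≤ σ) (hL : 0 < L) (hτ : 0 < τ) (hτq : τ * (q - k) = 2 * k + σ)
    (hθ : q < θ) (hms : ms = ((N:ℝ) + k) - 2 * k - k * τ) (hms0 : 0 < ms)
    (hJ : θ * (θ - k) * τ ≤ (θ - q) * (k * ms)) 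
    (w v : ℝ → ℝ) (h : Sol k N q σ L w v) (h1 : w 1 = 1) : L ≤ τ ^ k * ms := by
  have hkR : (0:ℝ) < k := by exact_mod_cast hk
  have hq0 : 0 < q := by linarith
  have hb : ∀ r ∈ Ioo (0:ℝ) 1, L * r ^ (2 * (k:ℝ) + σ) * w r ^ (q - k) ≤ τ ^ k * ms := by
    intro r hr
    have hr0 := hr.1
    have hv := vpos k N hk hN q σ L hq0 hσ hL w v h r hr
    have hw := h.pos r ⟨hr.1.le, hr.2.le⟩
    obtain ⟨hX, hZ⟩ := sol_barrier k N hk hN q σ L τ θ ms hq hσ hL hτ hτq hθ hms hJ w v h r hr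
    obtain ⟨m, hm⟩ : ∃ m, m = L * r ^ ((N:ℝ) + k + σ) * w r ^ q / (r ^ N * v r ^ k) := ⟨_, rfl⟩
    obtain ⟨p, hp⟩ : ∃ p, p = r * v r / w r := ⟨_, rfl⟩
    have hp0 : 0 < p := by rw [hp]; positivity
    have e : L * r ^ (2 * (k:ℝ) + σ) * w r ^ (q - k) = m * p ^ k := by
      have e1 : r ^ ((N:ℝ) + k + σ) * r ^ k = r ^ (2 * (k:ℝ) + σ) * r ^ N := by
        rw [← Real.rpow_natCast r k, ← Real.rpow_natCast r N, ← Real.rpow_add hr0, ← Real.rpow_add hr0]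
        congr 1; ring
      rw [hm, hp, Real.rpow_sub hw, Real.rpow_natCast, div_pow, mul_pow]
      field_simp
      linear_combination (-1) * e1
    rw [e]
    rw [← hm, ← hp] at hZ
    rw [← hp] at hX
    have hθ0 : 0 < θ := by linarith
    have hθms : θ * τ ≤ k * ms := by
      have h2 : (θ - k) * (θ * τ) ≤ (θ - k) * (k * ms) := by
        have h3 : 0 < k * ms := by positivity
        nlinarith
      exact le_of_mul_le_mul_left h2 (by linarith)
    have hXX : 0 < τ - p := by linarith
    have a1 : m ≤ ms * Real.exp (θ * (τ - p) / ms) := by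
      have := Real.add_one_le_exp (θ * (τ - p) / ms)
      calc m ≤ ms * (θ * (τ - p) / ms + 1) := by field_simp; linarith
        _ ≤ _ := by gcongr
    have a2 : p ≤ τ * Real.exp (-((τ - p) / τ)) := by
      have := Real.add_one_le_exp (-((τ - p) / τ))
      calc p = τ * (-((τ - p) / τ) + 1) := by field_simp; ring
        _ ≤ _ := by gcongr
    calc m * p ^ k ≤ (ms * Real.exp (θ * (τ - p) / ms)) * (τ * Real.exp (-((τ - p) / τ))) ^ k := by
          gcongr
      _ = τ ^ k * ms * Real.exp (θ * (τ - p) / ms + k * (-((τ - p) / τ))) := by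
          rw [mul_pow, ← Real.exp_nat_mul, Real.exp_add]; ring
      _ ≤ τ ^ k * ms * 1 := by
          gcongr
          rw [Real.exp_le_one_iff]
          have : θ * (τ - p) / ms + k * (-((τ - p) / τ)) = (τ - p) * (θ * τ - k * ms) / (ms * τ) := by
            field_simp; ring
          rw [this]
          apply div_nonpos_of_nonpos_of_nonneg _ (by positivity)
          nlinarith
      _ = τ ^ k * ms := mul_one _
  have hc : ContinuousWithinAt (fun r => L * r ^ (2 * (k:ℝ) + σ) * w r ^ (q - k)) (Ioo 0 1) 1 := by
    apply ContinuousWithinAt.mul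
    · exact ((Real.continuous_rpow_const (by positivity)).const_mul L |>.continuousWithinAt)
    · exact ((h.cont 1 (by simp)).mono Ioo_subset_Icc_self).rpow_const (Or.inr (by linarith))
  have hne : (nhdsWithin (1:ℝ) (Ioo 0 1)).NeBot := by
    rw [← mem_closure_iff_nhdsWithin_neBot, closure_Ioo zero_ne_one]; simp
  have := le_of_tendsto hc.tendsto (b := τ ^ k * ms) (by
    filter_upwards [self_mem_nhdsWithin] with s hs using hb s hs)
  simpa [h1] using this

lemma sliding (k N : ℕ) (hk : 1 ≤ k) (hN : 0 < N) (q σ L τ : ℝ) (hq : 0 < q)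
    (hL : 0 < L) (hτ : 0 < τ) (hτq : τ * (q - k) = 2 * k + σ)
    (w1 v1 w2 v2 : ℝ → ℝ) (h1 : Sol k N q σ L w1 v1) (h2 : Sol k N q σ L w2 v2)
    (e1 : w1 1 = 1) (e2 : w2 1 = 1)
    (hp : ∀ r ∈ Ioo (0:ℝ) 1, r * v2 r / w2 r < τ) : ∀ r ∈ Icc (0:ℝ) 1, w2 r ≤ w1 r := by
  have hmono : StrictMonoOn (fun b => b ^ τ * w2 b) (Icc 0 1) := by
    apply strictMonoOn_of_deriv_pos (convex_Icc 0 1)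
    · exact (Real.continuous_rpow_const hτ.le).continuousOn.mul h2.cont
    · rw [interior_Icc]
      intro b hb
      have hdd : deriv (fun b => b ^ τ * w2 b) b = _ :=
        ((Real.hasDerivAt_rpow_const (p := τ) (Or.inl hb.1.ne')).mul (h2.der b hb)).deriv
      rw [hdd]
      have hw := h2.pos b ⟨hb.1.le, hb.2.le⟩
      have := hp b hb
      rw [div_lt_iff₀ hw] at this
      have hb0 := hb.1
      rw [Real.rpow_sub_one hb0.ne']
      have e : τ * (b ^ τ / b) * w2 b + b ^ τ * -v2 b = b ^ τ / b * (τ * w2 b - b * v2 b) := by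
        field_simp; ring
      rw [e]
      exact mul_pos (by positivity) (by linarith)
  let cl : ℝ → ℝ := fun r => max 0 (min r 1)
  have hcl : Continuous cl := by fun_prop
  have hclI : ∀ r, cl r ∈ Icc (0:ℝ) 1 := fun r => ⟨le_max_left _ _, max_le zero_le_one (min_le_right _ _)⟩
  have hcle : ∀ r ∈ Icc (0:ℝ) 1, cl r = r := fun r hr => by simp [cl, hr.1, hr.2]
  have hW1 : Continuous (fun r => w1 (cl r)) := h1.cont.comp_continuous hcl hclI
  have hW2 : Continuous (fun r => w2 (cl r)) := h2.cont.comp_continuous hcl hclI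
  have hPhi1 : Continuous (fun z : ℝ × ℝ => z.1 ^ τ * w2 (cl (z.1 * z.2))) := by
    exact ((Real.continuous_rpow_const hτ.le).comp continuous_fst).mul (hW2.comp (by fun_prop : Continuous fun z : ℝ × ℝ => z.1 * z.2))
  have hPhi2 : Continuous (fun z : ℝ × ℝ => w1 (cl z.2)) := hW1.comp continuous_snd
  let A : Set ℝ := {b | ∀ r ∈ Icc (0:ℝ) 1, b ^ τ * w2 (cl (b * r)) ≤ w1 (cl r)}
  have hAcl : IsClosed A := by
    have : A = ⋂ r ∈ Icc (0:ℝ) 1, {b | b ^ τ * w2 (cl (b * r)) ≤ w1 (cl r)} := by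
      ext b; simp [A]
    rw [this]
    refine isClosed_biInter fun r _ => isClosed_le ?_ continuous_const
    exact hPhi1.comp (by fun_prop : Continuous fun b : ℝ => (b, r))
  have hsub : Icc (0:ℝ) 1 ⊆ A := by
    apply IsClosed.Icc_subset_of_forall_mem_nhdsWithin
    · exact hAcl.inter isClosed_Icc
    · intro r hr
      rw [Real.zero_rpow hτ.ne', zero_mul]
      exact (h1.pos _ (hclI r)).le
    · rintro b ⟨hbA, hb⟩
      have hstrict : ∀ r ∈ Icc (0:ℝ) 1, b ^ τ * w2 (cl (b * r)) < w1 (cl r) := by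
        rcases hb.1.eq_or_lt with h0 | h0
        · intro r hr
          rw [← h0, Real.zero_rpow hτ.ne', zero_mul]
          exact (h1.pos _ (hclI r))
        · have hs := h2.scale k N q σ L τ hτq w2 v2 b h0 hb.2.le
          have hbI : ∀ r ∈ Icc (0:ℝ) 1, b * r ∈ Icc (0:ℝ) 1 := fun r hr =>
            ⟨mul_nonneg h0.le hr.1, by nlinarith [hr.1, hr.2, hb.2]⟩
          have hcmp := compare k N hk hN v1 _ _ _ h1.vnn hs.vnn h1.vbd hs.vbd h1.ode hs.ode (by
            intro r hr
            have hr0 := hr.1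
            have hrI : r ∈ Icc (0:ℝ) 1 := ⟨hr.1.le, hr.2.le⟩
            have := hbA r hrI
            rw [hcle _ hrI, hcle _ (hbI r hrI)] at this
            have h3 := hs.pos r hrI
            gcongr)
          have hanti : AntitoneOn (fun r => w1 r - b ^ τ * w2 (b * r)) (Icc 0 1) := by
            apply antitoneOn_of_deriv_nonpos (convex_Icc 0 1)
            · exact h1.cont.sub hs.cont
            · rw [interior_Icc]
              exact fun r hr => ((h1.der r hr).sub (hs.der r hr)).differentiableAt.differentiableWithinAt
            · rw [interior_Icc]
              intro r hr
              have := ((h1.der r hr).sub (hs.der r hr)).deriv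
              have h4 := hcmp r hr
              have e : (fun r => w1 r - b ^ τ * w2 (b * r)) = (w1 - fun r => b ^ τ * w2 (b * r)) := rfl
              rw [e, this]; linarith
          intro r hr
          rw [hcle _ hr, hcle _ (hbI r hr)]
          have h5 := hanti hr ⟨zero_le_one, le_rfl⟩ hr.2
          have h6 := hmono ⟨h0.le, hb.2.le⟩ ⟨zero_le_one, le_rfl⟩ hb.2
          simp only [mul_one, e1, e2, Real.one_rpow] at h5 h6
          linarith
      have := isCompact_Icc.eventually_forall_of_forall_eventually (x₀ := b)
        (K := Icc (0:ℝ) 1) (P := fun b r => b ^ τ * w2 (cl (b * r)) < w1 (cl r)) (by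
          intro r hr
          exact hPhi1.continuousAt.eventually_lt hPhi2.continuousAt (hstrict r hr))
      refine mem_nhdsWithin_of_mem_nhds ?_
      filter_upwards [this] with c hc r hr using (hc r hr).le
  intro r hr
  have := hsub ⟨zero_le_one, le_rfl⟩ r hr
  simpa [hcle r hr] using this

def clp (r : ℝ) : ℝ := max 0 (min r 1)

def If (E q : ℝ) (f : ℝ → ℝ) (s : ℝ) : ℝ := ∫ t in (0:ℝ)..s, t ^ (E - 1) * f t ^ q

def Vf (k N : ℕ) (E q L : ℝ) (f : ℝ → ℝ) (s : ℝ) : ℝ := (L * If E q f s / s ^ N) ^ ((1:ℝ) / k)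

def Tf (k N : ℕ) (E q L : ℝ) (f : ℝ → ℝ) (r : ℝ) : ℝ :=
  1 + ∫ t in r..1, Vf k N E q L f (clp t)

lemma clp_cont : Continuous clp := by unfold clp; fun_prop

lemma clp_mem (r : ℝ) : clp r ∈ Icc (0:ℝ) 1 :=
  ⟨le_max_left _ _, max_le zero_le_one (min_le_right _ _)⟩

lemma clp_eq (r : ℝ) (hr : r ∈ Icc (0:ℝ) 1) : clp r = r := by simp [clp, hr.1, hr.2]

lemma If_integrand_cont (E q : ℝ) (hE : 1 ≤ E) (hq : 0 ≤ q) (f : ℝ → ℝ) (hf : Continuous f) :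
    Continuous (fun t => t ^ (E - 1) * f t ^ q) :=
  (Real.continuous_rpow_const (by linarith)).mul (hf.rpow_const fun _ => Or.inr hq)

lemma If_deriv (E q : ℝ) (hE : 1 ≤ E) (hq : 0 ≤ q) (f : ℝ → ℝ) (hf : Continuous f) (s : ℝ) :
    HasDerivAt (If E q f) (s ^ (E - 1) * f s ^ q) s :=
  ((If_integrand_cont E q hE hq f hf).integral_hasStrictDerivAt 0 s).hasDerivAt

lemma If_mono (E q : ℝ) (hE : 1 ≤ E) (hq : 0 ≤ q) (f g : ℝ → ℝ) (hf : Continuous f)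
    (hg : Continuous g) (hf0 : ∀ t ∈ Icc (0:ℝ) 1, 0 ≤ f t) (hfg : ∀ t ∈ Icc (0:ℝ) 1, f t ≤ g t)
    (s : ℝ) (hs : s ∈ Icc (0:ℝ) 1) : If E q f s ≤ If E q g s := by
  apply intervalIntegral.integral_mono_on hs.1
  · exact (If_integrand_cont E q hE hq f hf).intervalIntegrable _ _
  · exact (If_integrand_cont E q hE hq g hg).intervalIntegrable _ _
  · intro t ht
    have h1 : t ∈ Icc (0:ℝ) 1 := ⟨ht.1, ht.2.trans hs.2⟩
    have h2 := hf0 t h1; have h3 := hfg t h1; have h4 := ht.1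
    gcongr

lemma If_nonneg (E q : ℝ) (f : ℝ → ℝ) (hf0 : ∀ t ∈ Icc (0:ℝ) 1, 0 ≤ f t)
    (s : ℝ) (hs : s ∈ Icc (0:ℝ) 1) : 0 ≤ If E q f s := by
  apply intervalIntegral.integral_nonneg hs.1
  intro t ht
  have h2 := hf0 t ⟨ht.1, ht.2.trans hs.2⟩; have h4 := ht.1
  positivity

lemma If_pos (E q : ℝ) (hE : 1 ≤ E) (hq : 0 ≤ q) (f : ℝ → ℝ) (hf : Continuous f)
    (hf0 : ∀ t ∈ Icc (0:ℝ) 1, 0 < f t)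
    (s : ℝ) (hs : s ∈ Icc (0:ℝ) 1) (hs0 : 0 < s) : 0 < If E q f s := by
  apply intervalIntegral.intervalIntegral_pos_of_pos_on 
  · exact (If_integrand_cont E q hE hq f hf).intervalIntegrable _ _
  · intro t ht
    have h2 := hf0 t ⟨ht.1.le, ht.2.le.trans hs.2⟩; have h4 := ht.1
    positivity
  · exact hs0

lemma If_le (E q C : ℝ) (hE : 1 ≤ E) (hq : 0 ≤ q) (f : ℝ → ℝ)
    (hf0 : ∀ t ∈ Icc (0:ℝ) 1, 0 ≤ f t) (hC : ∀ t ∈ Icc (0:ℝ) 1, f t ≤ C)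
    (s : ℝ) (hs : s ∈ Icc (0:ℝ) 1) : If E q f s ≤ s ^ E * C ^ q := by
  rcases hs.1.eq_or_lt with h | h
  · rw [← h]; simp [If, Real.zero_rpow (by linarith : E ≠ 0)]
  have := intervalIntegral.norm_integral_le_of_norm_le_const (a := 0) (b := s)
    (C := s ^ (E - 1) * C ^ q) (f := fun t => t ^ (E - 1) * f t ^ q) (by
      intro t ht
      rw [uIoc_of_le hs.1] at ht
      have h1 : t ∈ Icc (0:ℝ) 1 := ⟨ht.1.le, ht.2.trans hs.2⟩
      have h2 := hf0 t h1; have h3 := hC t h1; have h4 := ht.1; have h5 := ht.2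
      rw [Real.norm_of_nonneg (by positivity)]
      gcongr)
  rw [sub_zero, abs_of_pos h] at this
  calc If E q f s ≤ ‖If E q f s‖ := Real.le_norm_self _
    _ ≤ s ^ (E - 1) * C ^ q * s := this
    _ = s ^ E * C ^ q := by rw [Real.rpow_sub_one h.ne']; field_simp

lemma Vf_nonneg (k N : ℕ) (E q L : ℝ) (hL : 0 < L) (f : ℝ → ℝ) 
    (hf0 : ∀ t ∈ Icc (0:ℝ) 1, 0 ≤ f t) (s : ℝ) (hs : s ∈ Icc (0:ℝ) 1) : 0 ≤ Vf k N E q L f s := by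
  have := If_nonneg E q f hf0 s hs
  have := hs.1
  unfold Vf; positivity

lemma Vf_pow (k N : ℕ) (hk : 1 ≤ k) (E q L : ℝ) (hL : 0 < L) (f : ℝ → ℝ) 
    (hf0 : ∀ t ∈ Icc (0:ℝ) 1, 0 ≤ f t) (s : ℝ) (hs : s ∈ Icc (0:ℝ) 1) (hs0 : 0 < s) :
    s ^ N * Vf k N E q L f s ^ k = L * If E q f s := by
  have := If_nonneg E q f hf0 s hs
  unfold Vf
  rw [one_div, Real.rpow_inv_natCast_pow (by positivity) (by omega)]
  field_simp

lemma Vf_mono (k N : ℕ) (E q L : ℝ) (hE : 1 ≤ E) (hq : 0 ≤ q) (hL : 0 < L) (f g : ℝ → ℝ)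
    (hf : Continuous f) (hg : Continuous g) (hf0 : ∀ t ∈ Icc (0:ℝ) 1, 0 ≤ f t)
    (hfg : ∀ t ∈ Icc (0:ℝ) 1, f t ≤ g t)
    (s : ℝ) (hs : s ∈ Icc (0:ℝ) 1) : Vf k N E q L f s ≤ Vf k N E q L g s := by
  have h1 := If_nonneg E q f hf0 s hs
  have h2 := If_mono E q hE hq f g hf hg hf0 hfg s hs
  have := hs.1
  unfold Vf
  gcongr

lemma Vf_le (k N : ℕ) (hk : 1 ≤ k) (E q L C : ℝ) (hE1 : 1 ≤ E) (hE : (N:ℝ) + k ≤ E) (hq : 0 ≤ q)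
    (hL : 0 < L) (f : ℝ → ℝ) (hf0 : ∀ t ∈ Icc (0:ℝ) 1, 0 ≤ f t) (hC : ∀ t ∈ Icc (0:ℝ) 1, f t ≤ C)
    (s : ℝ) (hs : s ∈ Icc (0:ℝ) 1) : Vf k N E q L f s ≤ (L * C ^ q) ^ ((1:ℝ) / k) * s := by
  have hkR : (0:ℝ) < k := by exact_mod_cast hk
  have hC0 : 0 ≤ C := (hf0 0 (by simp)).trans (hC 0 (by simp))
  rcases hs.1.eq_or_lt with h | h
  · rw [← h]; simp [Vf, If]; rw [Real.zero_rpow (by positivity)]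
  have h1 := If_le E q C hE1 hq f hf0 hC s hs
  have h0 := If_nonneg E q f hf0 s hs
  have h2 : s ^ E ≤ s ^ N * s ^ k := by
    rw [← pow_add, ← Real.rpow_natCast s (N + k)]
    exact Real.rpow_le_rpow_of_exponent_ge h hs.2 (by push_cast; exact hE)
  unfold Vf
  calc (L * If E q f s / s ^ N) ^ ((1:ℝ) / k) ≤ (L * C ^ q * s ^ k) ^ ((1:ℝ) / k) := by
        apply Real.rpow_le_rpow (by positivity) _ (by positivity)
        rw [div_le_iff₀ (by positivity)]
        calc L * If E q f s ≤ L * (s ^ E * C ^ q) := by gcongr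
          _ ≤ L * ((s ^ N * s ^ k) * C ^ q) := by gcongr
          _ = _ := by ring
    _ = _ := by
      rw [Real.mul_rpow (by positivity) (by positivity), one_div, Real.pow_rpow_inv_natCast h.le (by omega)]

lemma Vf_zero (k N : ℕ) (hk : 1 ≤ k) (E q L : ℝ) (f : ℝ → ℝ) : Vf k N E q L f 0 = 0 := by
  have hkR : (0:ℝ) < k := by exact_mod_cast hk
  simp [Vf, If]; rw [Real.zero_rpow (by positivity)]

lemma Vf_cont (k N : ℕ) (hk : 1 ≤ k) (E q L C : ℝ) (hE1 : 1 ≤ E) (hE : (N:ℝ) + k ≤ E) (hq : 0 ≤ q)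
    (hL : 0 < L) (f : ℝ → ℝ) (hf : Continuous f)
    (hf0 : ∀ t ∈ Icc (0:ℝ) 1, 0 ≤ f t) (hC : ∀ t ∈ Icc (0:ℝ) 1, f t ≤ C) :
    Continuous (fun t => Vf k N E q L f (clp t)) := by
  have hkR : (0:ℝ) < k := by exact_mod_cast hk
  have : ContinuousOn (Vf k N E q L f) (Icc 0 1) := by
    intro s hs
    rcases hs.1.eq_or_lt with h | h
    · rw [← h]
      unfold ContinuousWithinAt
      rw [Vf_zero k N hk]
      have h1 : Tendsto (fun s => (L * C ^ q) ^ ((1:ℝ) / k) * s) (nhdsWithin 0 (Icc 0 1)) (nhds 0) := by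
        have : Continuous (fun s => (L * C ^ q) ^ ((1:ℝ) / k) * s) := by fun_prop
        simpa using (this.tendsto 0).mono_left (nhdsWithin_le_nhds (s := Icc (0:ℝ) 1))
      refine squeeze_zero' ?_ ?_ h1
      · filter_upwards [self_mem_nhdsWithin] with s hs using Vf_nonneg k N E q L hL f hf0 s hs
      · filter_upwards [self_mem_nhdsWithin] with s hs using Vf_le k N hk E q L C hE1 hE hq hL f hf0 hC s hs
    · apply ContinuousAt.continuousWithinAt
      have h1 := (If_deriv E q hE1 hq f hf s).continuousAt
      unfold Vf
      exact ((h1.const_mul L).div (by fun_prop) (by positivity)).rpow_const (Or.inr (by positivity))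
  exact this.comp_continuous clp_cont clp_mem

lemma Tf_deriv (k N : ℕ) (E q L : ℝ) (f : ℝ → ℝ)
    (hc : Continuous (fun t => Vf k N E q L f (clp t))) (r : ℝ) :
    HasDerivAt (Tf k N E q L f) (-(Vf k N E q L f (clp r))) r := by
  have h1 := (hc.integral_hasStrictDerivAt 1 r).hasDerivAt
  have : Tf k N E q L f = fun r => 1 - ∫ t in (1:ℝ)..r, Vf k N E q L f (clp t) := by
    funext r; unfold Tf; rw [intervalIntegral.integral_symm]; ring
  rw [this]
  exact h1.const_sub 1

lemma Tf_one (k N : ℕ) (E q L : ℝ) (f : ℝ → ℝ) : Tf k N E q L f 1 = 1 := by simp [Tf]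

lemma one_le_Tf (k N : ℕ) (E q L : ℝ) (hL : 0 < L) (f : ℝ → ℝ)
    (hf0 : ∀ t ∈ Icc (0:ℝ) 1, 0 ≤ f t) (r : ℝ) (hr : r ∈ Icc (0:ℝ) 1) : 1 ≤ Tf k N E q L f r := by
  unfold Tf
  have : 0 ≤ ∫ t in r..1, Vf k N E q L f (clp t) :=
    intervalIntegral.integral_nonneg hr.2 fun t _ => Vf_nonneg k N E q L hL f hf0 _ (clp_mem t)
  linarith

lemma Tf_mono (k N : ℕ) (E q L : ℝ) (hE : 1 ≤ E) (hq : 0 ≤ q) (hL : 0 < L) (f g : ℝ → ℝ)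
    (hf : Continuous f) (hg : Continuous g) (hf0 : ∀ t ∈ Icc (0:ℝ) 1, 0 ≤ f t)
    (hfg : ∀ t ∈ Icc (0:ℝ) 1, f t ≤ g t) (hcf : Continuous (fun t => Vf k N E q L f (clp t)))
    (hcg : Continuous (fun t => Vf k N E q L g (clp t)))
    (r : ℝ) (hr : r ∈ Icc (0:ℝ) 1) : Tf k N E q L f r ≤ Tf k N E q L g r := by
  unfold Tf
  have := intervalIntegral.integral_mono_on (μ := volume) hr.2 (hcf.intervalIntegrable r 1) (hcg.intervalIntegrable r 1)
    (fun t _ => Vf_mono k N E q L hE hq hL f g hf hg hf0 hfg _ (clp_mem t))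
  linarith

/-- comparison with a supersolution -/
lemma Tf_le_super (k N : ℕ) (hk : 1 ≤ k) (hN : 0 < N) (E q L C : ℝ) (hE1 : 1 ≤ E)
    (hE : (N:ℝ) + k ≤ E) (hq : 0 ≤ q)
    (hL : 0 < L) (wb vb g : ℝ → ℝ) (hwc : ContinuousOn wb (Icc 0 1)) (hw1 : wb 1 = 1)
    (hwd : ∀ r ∈ Ioo (0:ℝ) 1, HasDerivAt wb (-(vb r)) r)
    (hv0 : ∀ r ∈ Ioo (0:ℝ) 1, 0 ≤ vb r) (hvb : ∃ M, ∀ r ∈ Ioo (0:ℝ) 1, vb r ≤ M)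
    (hg : ∀ r ∈ Ioo (0:ℝ) 1, HasDerivAt (fun s => s ^ N * vb s ^ k) (g r) r)
    (hgL : ∀ r ∈ Ioo (0:ℝ) 1, L * r ^ (E - 1) * wb r ^ q ≤ g r)
    (hwC : ∀ t ∈ Icc (0:ℝ) 1, wb t ≤ C)
    (f : ℝ → ℝ) (hf : Continuous f) (hf0 : ∀ t ∈ Icc (0:ℝ) 1, 0 ≤ f t)
    (hfw : ∀ t ∈ Icc (0:ℝ) 1, f t ≤ wb t) (r : ℝ) (hr : r ∈ Icc (0:ℝ) 1) :
    Tf k N E q L f r ≤ wb r := by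
  have hfC : ∀ t ∈ Icc (0:ℝ) 1, f t ≤ C := fun t ht => (hfw t ht).trans (hwC t ht)
  have hc := Vf_cont k N hk E q L C hE1 hE hq hL f hf hf0 hfC
  have hIc : ∀ r ∈ Ioo (0:ℝ) 1, r ∈ Icc (0:ℝ) 1 := fun r hr => ⟨hr.1.le, hr.2.le⟩
  have hode : ∀ r ∈ Ioo (0:ℝ) 1, HasDerivAt (fun s => s ^ N * Vf k N E q L f s ^ k)
      (L * (r ^ (E - 1) * f r ^ q)) r := by
    intro r hr
    refine ((If_deriv E q hE1 hq f hf r).const_mul L).congr_of_eventuallyEq ?_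
    filter_upwards [Ioo_mem_nhds hr.1 hr.2] with s hs
    exact Vf_pow k N hk E q L hL f hf0 s (hIc s hs) hs.1
  have hcmp := compare k N hk hN vb (Vf k N E q L f) g _ hv0
    (fun r hr => Vf_nonneg k N E q L hL f hf0 r (hIc r hr)) hvb
    ⟨(L * C ^ q) ^ ((1:ℝ) / k) * 1, fun r hr => 
      (Vf_le k N hk E q L C hE1 hE hq hL f hf0 hfC r (hIc r hr)).trans (by
        have : 0 ≤ C := (hf0 0 (by simp)).trans (hfC 0 (by simp))
        have := hr.2.le
        gcongr)⟩ hg hode (by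
      intro r hr
      refine le_trans ?_ (hgL r hr)
      have h1 := hf0 r (hIc r hr); have h2 := hfw r (hIc r hr); have h3 := hr.1
      rw [← mul_assoc]
      gcongr)
  have hanti : AntitoneOn (fun r => wb r - Tf k N E q L f r) (Icc 0 1) := by
    have hd : ∀ r ∈ Ioo (0:ℝ) 1, HasDerivAt (fun r => wb r - Tf k N E q L f r) _ r := fun r hr =>
      (hwd r hr).sub (Tf_deriv k N E q L f hc r)
    apply antitoneOn_of_deriv_nonpos (convex_Icc 0 1)
    · exact hwc.sub (fun r _ => (Tf_deriv k N E q L f hc r).continuousAt.continuousWithinAt)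
    · rw [interior_Icc]
      exact fun r hr => (hd r hr).differentiableAt.differentiableWithinAt
    · rw [interior_Icc]
      intro r hr
      rw [(hd r hr).deriv, clp_eq r (hIc r hr)]
      have := hcmp r hr
      linarith
  have := hanti hr ⟨zero_le_one, le_rfl⟩ hr.2
  simp only [hw1, Tf_one] at this
  linarith

/-- explicit bounded supersolution -/
lemma super_exists (k N : ℕ) (hk : 1 ≤ k) (q σ L τ ms : ℝ) (hq : k < q)
    (hσ : 0 ≤ σ) (hL : 0 < L) (hτ : 0 < τ) (hτq : τ * (q - k) = 2 * k + σ)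
    (hms : ms = ((N:ℝ) + k) - 2 * k - k * τ) (hms0 : 0 < ms) (hLt : L < τ ^ k * ms) :
    ∃ wb vb g : ℝ → ℝ, ∃ C : ℝ, ContinuousOn wb (Icc 0 1) ∧ wb 1 = 1 ∧
    (∀ r ∈ Ioo (0:ℝ) 1, HasDerivAt wb (-(vb r)) r) ∧
    (∀ r ∈ Ioo (0:ℝ) 1, 0 ≤ vb r) ∧ (∃ M, ∀ r ∈ Ioo (0:ℝ) 1, vb r ≤ M) ∧
    (∀ r ∈ Ioo (0:ℝ) 1, HasDerivAt (fun s => s ^ N * vb s ^ k) (g r) r) ∧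
    (∀ r ∈ Ioo (0:ℝ) 1, L * r ^ ((N:ℝ) + k + σ - 1) * wb r ^ q ≤ g r) ∧
    (∀ t ∈ Icc (0:ℝ) 1, wb t ≤ C) := by
  have hkR : (0:ℝ) < k := by exact_mod_cast hk
  obtain ⟨E, hE⟩ : ∃ E, E = (N:ℝ) + k + σ := ⟨_, rfl⟩
  rw [← hE]
  obtain ⟨a, ha⟩ : ∃ a, a = (2 * k + σ) / (k:ℝ) := ⟨_, rfl⟩
  have hka : k * a = 2 * k + σ := by rw [ha]; field_simp
  have ha1 : 1 < a := by
    have : (k:ℝ) * 1 < k * a := by rw [hka]; linarith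
    exact lt_of_mul_lt_mul_left this hkR.le
  have ha0 : 0 < a := by linarith
  have hqk : 0 < q - k := by linarith
  obtain ⟨B, hB⟩ : ∃ B, B = (τ ^ k * ms / L) ^ (1 / (q - k)) := ⟨_, rfl⟩
  have hB1 : 1 < B := by
    rw [hB]
    apply Real.one_lt_rpow _ (by positivity)
    rw [lt_div_iff₀ hL]; linarith
  have hB0 : 0 < B := by linarith
  have hBL : L * B ^ (q - k) = τ ^ k * ms := by
    rw [hB, ← Real.rpow_mul (by positivity), one_div, inv_mul_cancel₀ hqk.ne', Real.rpow_one]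
    field_simp
  obtain ⟨ε, hε⟩ : ∃ ε, ε = B ^ (a / τ) - 1 := ⟨_, rfl⟩
  have hε0 : 0 < ε := by
    have : 1 < B ^ (a / τ) := Real.one_lt_rpow hB1 (by positivity)
    linarith
  have hD : ∀ r : ℝ, 0 ≤ r → 0 < r ^ a + ε := fun r hr => by positivity
  have hDder : ∀ r : ℝ, 0 < r → HasDerivAt (fun r : ℝ => r ^ a + ε) (a * r ^ (a - 1)) r := fun r hr =>
    (Real.hasDerivAt_rpow_const (Or.inl hr.ne')).add_const ε
  obtain ⟨γ, hγ⟩ : ∃ γ, γ = k * (τ / a + 1) := ⟨_, rfl⟩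
  have hγa : γ * a = k * τ + 2 * k + σ := by rw [hγ, add_assoc, ← hka]; field_simp
  have hγq : -(τ / a) * q = -γ := by
    have : τ * q = γ * a := by rw [hγa]; linarith
    have h2 : q = γ * a / τ := by rw [← this]; field_simp
    rw [h2]; field_simp
  refine ⟨fun r => B * (r ^ a + ε) ^ (-(τ / a)),
    fun r => B * τ * r ^ (a - 1) * (r ^ a + ε) ^ (-(τ / a) - 1),
    fun r => B ^ k * τ ^ k * (E * r ^ (E - 1) * (r ^ a + ε) ^ (-γ) +
      r ^ E * (a * r ^ (a - 1) * (-γ) * (r ^ a + ε) ^ (-γ - 1))), B * ε ^ (-(τ / a)),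
      ?_, ?_, ?_, ?_, ?_, ?_, ?_, ?_⟩
  · intro r hr
    have h1 : Continuous (fun r : ℝ => r ^ a + ε) := (Real.continuous_rpow_const ha0.le).add continuous_const
    exact (h1.continuousAt.rpow_const (Or.inl (hD r hr.1).ne')).const_mul B |>.continuousWithinAt
  · simp only [Real.one_rpow]
    have : 1 + ε = B ^ (a / τ) := by rw [hε]; ring
    rw [this, ← Real.rpow_mul hB0.le]
    have : a / τ * -(τ / a) = -1 := by field_simp
    rw [this, Real.rpow_neg_one]; field_simp
  · intro r hr
    refine HasDerivAt.congr_deriv (((hDder r hr.1).rpow_const (p := -(τ / a)) (Or.inl (hD r hr.1.le).ne')).const_mul B) ?_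
    field_simp
  · intro r hr
    have := hD r hr.1.le; have := hr.1
    positivity
  · refine ⟨B * τ * 1 * ε ^ (-(τ / a) - 1), fun r hr => ?_⟩
    have h1 := hD r hr.1.le; have h2 := hr.1
    have h3 : r ^ (a - 1) ≤ 1 := Real.rpow_le_one h2.le hr.2.le (by linarith)
    have h4 : (r ^ a + ε) ^ (-(τ / a) - 1) ≤ ε ^ (-(τ / a) - 1) := by
      apply Real.rpow_le_rpow_of_nonpos hε0
      · have : 0 < r ^ a := by positivity
        linarith
      · have : 0 < τ / a := by positivity
        linarith
    exact mul_le_mul (mul_le_mul_of_nonneg_left h3 (by positivity)) h4 (by positivity) (by positivity)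
  · intro r hr
    have h2 := hr.1
    have key := ((Real.hasDerivAt_rpow_const (p := E) (Or.inl h2.ne')).mul
      ((hDder r h2).rpow_const (p := -γ) (Or.inl (hD r h2.le).ne'))).const_mul (B ^ k * τ ^ k)
    refine key.congr_of_eventuallyEq ?_
    filter_upwards [lt_mem_nhds h2] with s hs
    have hDs := hD s hs.le
    simp only [Pi.mul_apply]
    have e1 : s ^ E = s ^ N * (s ^ (a - 1)) ^ k := by
      rw [← Real.rpow_natCast s N, ← Real.rpow_natCast (s ^ (a-1)) k, ← Real.rpow_mul hs.le, ← Real.rpow_add hs]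
      congr 1; rw [hE]; linarith
    have e2 : (s ^ a + ε) ^ (-γ) = ((s ^ a + ε) ^ (-(τ / a) - 1)) ^ k := by
      rw [← Real.rpow_natCast (_ ^ _) k, ← Real.rpow_mul hDs.le]
      congr 1; rw [hγ]; ring
    rw [e1, e2]; ring
  · intro r hr
    have h2 := hr.1
    have hDr := hD r h2.le
    obtain ⟨D, hDe⟩ : ∃ D, D = r ^ a + ε := ⟨_, rfl⟩
    simp only
    rw [← hDe] at hDr ⊢
    have e1 : (B * D ^ (-(τ / a))) ^ q = B ^ (q - k) * B ^ k * D ^ (-γ) := by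
      rw [Real.mul_rpow hB0.le (by positivity), ← Real.rpow_mul hDr.le, hγq, ← Real.rpow_natCast B k,
        ← Real.rpow_add hB0]
      simp
    rw [e1, Real.rpow_sub_one hDr.ne' (-γ), Real.rpow_sub_one h2.ne', Real.rpow_sub_one h2.ne']
    have e2 : B ^ k * τ ^ k * (E * (r ^ E / r) * D ^ (-γ) + r ^ E * (a * (r ^ a / r) * -γ * (D ^ (-γ) / D)))
      - L * (r ^ E / r) * (B ^ (q - k) * B ^ k * D ^ (-γ)) = 
       B ^ k * τ ^ k * (r ^ E / r) * (D ^ (-γ) / D) * ((E - ms) * ε) := by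
      have e3 : L * (r ^ E / r) * (B ^ (q - k) * B ^ k * D ^ (-γ)) =
        (L * B ^ (q - k)) * (r ^ E / r) * B ^ k * D ^ (-γ) := by ring
      have e4 : ms = E - γ * a := by rw [hms, hE, hγa]; ring
      rw [e3, hBL, e4]
      have e5 : r ^ a = D - ε := by rw [hDe]; ring
      rw [e5]
      field_simp
      ring
    have h6 : 0 ≤ E - ms := by
      have h7 : 0 < k * τ := by positivity
      rw [hE, hms]; linarith
    have h5 : 0 ≤ B ^ k * τ ^ k * (r ^ E / r) * (D ^ (-γ) / D) * ((E - ms) * ε) := by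
      positivity
    linarith
  · intro t ht
    simp only
    have : (t ^ a + ε) ^ (-(τ / a)) ≤ ε ^ (-(τ / a)) := by
      apply Real.rpow_le_rpow_of_nonpos hε0
      · have : 0 ≤ t ^ a := Real.rpow_nonneg ht.1 a
        linarith
      · have : 0 < τ / a := by positivity
        linarith
    gcongr

lemma sol_exists (k N : ℕ) (hk : 1 ≤ k) (hN : 0 < N) (q σ L τ ms : ℝ) (hq : k < q)
    (hσ : 0 ≤ σ) (hL : 0 < L) (hτ : 0 < τ) (hτq : τ * (q - k) = 2 * k + σ)
    (hms : ms = ((N:ℝ) + k) - 2 * k - k * τ) (hms0 : 0 < ms) (hLt : L < τ ^ k * ms) :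
    ∃ W V : ℝ → ℝ, (∀ r, HasDerivAt W (-(V r)) r) ∧ Continuous V ∧ V 0 = 0 ∧ W 1 = 1 ∧
      (∀ r ∈ Ioo (0:ℝ) 1, 0 < V r) ∧ ContDiffOn ℝ 1 V (Ioo 0 1) ∧
      (∀ r ∈ Ioo (0:ℝ) 1, HasDerivAt (fun s => s ^ N * V s ^ k)
        (L * r ^ ((N:ℝ) + k + σ - 1) * W r ^ q) r) := by
  have hkR : (0:ℝ) < k := by exact_mod_cast hk
  have hk1 : (1:ℝ) ≤ k := by exact_mod_cast hk
  obtain ⟨wb, vb, g, C, hwc, hw1, hwd, hv0, hvb, hg, hgL, hwC⟩ :=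
    super_exists k N hk q σ L τ ms hq hσ hL hτ hτq hms hms0 hLt
  obtain ⟨E, hEe⟩ : ∃ E, E = (N:ℝ) + k + σ := ⟨_, rfl⟩
  rw [← hEe] at hgL ⊢
  have hE : (N:ℝ) + k ≤ E := by linarith
  have hE1 : 1 ≤ E := by
    have : (0:ℝ) ≤ N := by positivity
    linarith
  have hq0 : 0 ≤ q := by linarith
  have hIc : ∀ r ∈ Ioo (0:ℝ) 1, r ∈ Icc (0:ℝ) 1 := fun r hr => ⟨hr.1.le, hr.2.le⟩
  have hwb1 : ∀ t ∈ Icc (0:ℝ) 1, 1 ≤ wb t := by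
    have hanti : AntitoneOn wb (Icc 0 1) := by
      apply antitoneOn_of_deriv_nonpos (convex_Icc 0 1) hwc
      · rw [interior_Icc]; exact fun r hr => (hwd r hr).differentiableAt.differentiableWithinAt
      · rw [interior_Icc]; intro r hr; rw [(hwd r hr).deriv]; linarith [hv0 r hr]
    intro t ht
    have := hanti ht ⟨zero_le_one, le_rfl⟩ ht.2
    rwa [hw1] at this
  -- good functions
  let Good : (ℝ → ℝ) → Prop := fun f => Continuous f ∧ ∀ t ∈ Icc (0:ℝ) 1, 1 ≤ f t ∧ f t ≤ wb t
  have gc : ∀ f, Good f → Continuous (fun t => Vf k N E q L f (clp t)) := fun f hf =>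
    Vf_cont k N hk E q L C hE1 hE hq0 hL f hf.1 (fun t ht => by linarith [(hf.2 t ht).1])
      (fun t ht => (hf.2 t ht).2.trans (hwC t ht))
  have gT : ∀ f, Good f → Good (Tf k N E q L f) := by
    intro f hf
    have h0 : ∀ t ∈ Icc (0:ℝ) 1, 0 ≤ f t := fun t ht => by linarith [(hf.2 t ht).1]
    refine ⟨continuous_iff_continuousAt.2 fun r => (Tf_deriv k N E q L f (gc f hf) r).continuousAt, ?_⟩
    intro r hr
    exact ⟨one_le_Tf k N E q L hL f h0 r hr, Tf_le_super k N hk hN E q L C hE1 hE hq0 hL wb vb g hwc hw1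
      hwd hv0 hvb hg hgL hwC f hf.1 h0 (fun t ht => (hf.2 t ht).2) r hr⟩
  let w : ℕ → ℝ → ℝ := fun j => (Tf k N E q L)^[j] (fun _ => 1)
  have hws : ∀ j, w (j+1) = Tf k N E q L (w j) := fun j => Function.iterate_succ_apply' _ _ _
  have hgood : ∀ j, Good (w j) := by
    intro j
    induction j with
    | zero => exact ⟨continuous_const, fun t ht => ⟨le_rfl, hwb1 t ht⟩⟩
    | succ j ih => rw [hws]; exact gT _ ih
  have h0 : ∀ f, Good f → ∀ t ∈ Icc (0:ℝ) 1, 0 ≤ f t := fun f hf t ht => by linarith [(hf.2 t ht).1]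
  have hmono : ∀ j, ∀ r ∈ Icc (0:ℝ) 1, w j r ≤ w (j+1) r := by
    intro j
    induction j with
    | zero => intro r hr; exact ((hgood 1).2 r hr).1
    | succ j ih =>
      intro r hr
      rw [hws j, hws (j+1)]
      exact Tf_mono k N E q L hE1 hq0 hL _ _ (hgood j).1 (hgood (j+1)).1 (h0 _ (hgood j)) ih
        (gc _ (hgood j)) (gc _ (hgood (j+1))) r hr
  let wi : ℝ → ℝ := fun r => ⨆ j, w j (clp r)
  have hlim : ∀ r ∈ Icc (0:ℝ) 1, Tendsto (fun j => w j r) atTop (nhds (wi r)) := by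
    intro r hr
    have := tendsto_atTop_ciSup (f := fun j => w j r) (monotone_nat_of_le_succ fun j => hmono j r hr)
      ⟨wb r, by rintro x ⟨j, rfl⟩; exact ((hgood j).2 r hr).2⟩
    simpa [wi, clp_eq r hr] using this
  -- Lipschitz
  have hC1 : 0 ≤ C := by linarith [hwC 0 (by simp), hwb1 0 (by simp)]
  obtain ⟨K, hK⟩ : ∃ K, K = (L * C ^ q) ^ ((1:ℝ) / k) := ⟨_, rfl⟩
  have hK0 : 0 ≤ K := by rw [hK]; positivity
  have hVK : ∀ f, Good f → ∀ s, |Vf k N E q L f (clp s)| ≤ K := by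
    intro f hf s
    have hs := clp_mem s
    rw [abs_of_nonneg (Vf_nonneg k N E q L hL f (h0 f hf) _ hs)]
    have := Vf_le k N hk E q L C hE1 hE hq0 hL f (h0 f hf) (fun t ht => (hf.2 t ht).2.trans (hwC t ht)) _ hs
    rw [← hK] at this
    nlinarith [hs.2]
  have hLip : ∀ j x y, |w j x - w j y| ≤ K * |x - y| := by
    intro j x y
    cases j with
    | zero => simp only [w, Function.iterate_zero, id]; simp; positivity
    | succ j =>
      rw [hws]
      have := Convex.norm_image_sub_le_of_norm_hasDerivWithin_le (s := univ) (C := K)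
        (f := Tf k N E q L (w j)) (f' := fun r => -(Vf k N E q L (w j) (clp r)))
        (fun r _ => (Tf_deriv k N E q L (w j) (gc _ (hgood j)) r).hasDerivWithinAt)
        (fun r _ => by rw [norm_neg]; exact hVK _ (hgood j) r) convex_univ (mem_univ y) (mem_univ x)
      exact this
  have hwiLip : ∀ x y, |wi x - wi y| ≤ K * |clp x - clp y| := by
    intro x y
    have e : ∀ x, wi x = wi (clp x) := fun x => by simp only [wi]; rw [clp_eq _ (clp_mem x)]
    rw [e x, e y]
    refine le_of_tendsto ((hlim _ (clp_mem x)).sub (hlim _ (clp_mem y))).abs ?_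
    exact Eventually.of_forall fun j => hLip j _ _
  have hwic : Continuous wi := by
    rw [continuous_iff_continuousAt]
    intro y
    rw [ContinuousAt, tendsto_iff_norm_sub_tendsto_zero]
    have h1 : Tendsto (fun x => K * |clp x - clp y|) (nhds y) (nhds 0) := by
      have : Continuous (fun x => K * |clp x - clp y|) := by
        have := clp_cont
        fun_prop
      simpa using this.tendsto y
    exact squeeze_zero (fun _ => norm_nonneg _) (fun x => hwiLip x y) h1
  have hwig : Good wi := ⟨hwic, fun t ht => ⟨
    ge_of_tendsto (hlim t ht) (Eventually.of_forall fun j => ((hgood j).2 t ht).1),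
    le_of_tendsto (hlim t ht) (Eventually.of_forall fun j => ((hgood j).2 t ht).2)⟩⟩
  -- passage to the limit
  have hI : ∀ s ∈ Icc (0:ℝ) 1, Tendsto (fun j => If E q (w j) s) atTop (nhds (If E q wi s)) := by
    intro s hs
    unfold If
    apply intervalIntegral.tendsto_integral_filter_of_dominated_convergence (fun t => t ^ (E - 1) * C ^ q)
    · exact Eventually.of_forall fun j =>
        (If_integrand_cont E q hE1 hq0 _ (hgood j).1).aestronglyMeasurable
    · refine Eventually.of_forall fun j => Eventually.of_forall fun t ht => ?_
      rw [uIoc_of_le hs.1] at ht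
      have h1 : t ∈ Icc (0:ℝ) 1 := ⟨ht.1.le, ht.2.trans hs.2⟩
      have h2 := h0 _ (hgood j) t h1
      have h3 := ((hgood j).2 t h1).2.trans (hwC t h1)
      have h4 := ht.1
      rw [Real.norm_of_nonneg (by positivity)]
      gcongr
    · exact ((Real.continuous_rpow_const (by linarith)).mul continuous_const).intervalIntegrable _ _
    · refine Eventually.of_forall fun t ht => ?_
      rw [uIoc_of_le hs.1] at ht
      have h1 : t ∈ Icc (0:ℝ) 1 := ⟨ht.1.le, ht.2.trans hs.2⟩
      exact ((hlim t h1).rpow_const (Or.inr hq0)).const_mul _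
  have hV : ∀ s ∈ Icc (0:ℝ) 1, Tendsto (fun j => Vf k N E q L (w j) s) atTop (nhds (Vf k N E q L wi s)) := by
    intro s hs
    unfold Vf
    exact (((hI s hs).const_mul L).div_const _).rpow_const (Or.inr (by positivity))
  have hT : ∀ r ∈ Icc (0:ℝ) 1, Tendsto (fun j => Tf k N E q L (w j) r) atTop (nhds (Tf k N E q L wi r)) := by
    intro r hr
    unfold Tf
    refine Tendsto.const_add 1 ?_
    apply intervalIntegral.tendsto_integral_filter_of_dominated_convergence (fun t => K)
    · exact Eventually.of_forall fun j => (gc _ (hgood j)).aestronglyMeasurable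
    · exact Eventually.of_forall fun j => Eventually.of_forall fun t _ => hVK _ (hgood j) t
    · exact continuous_const.intervalIntegrable _ _
    · exact Eventually.of_forall fun t _ => hV _ (clp_mem t)
  have hfix : ∀ r ∈ Icc (0:ℝ) 1, Tf k N E q L wi r = wi r := by
    intro r hr
    have h1 := (hlim r hr).comp (tendsto_add_atTop_nat 1)
    have h2 : (fun j => w j r) ∘ (fun a => a + 1) = fun j => Tf k N E q L (w j) r := by
      funext j; simp only [Function.comp]; rw [hws]
    rw [h2] at h1
    exact tendsto_nhds_unique (hT r hr) h1
  have hwpos : ∀ t ∈ Icc (0:ℝ) 1, 0 < wi t := fun t ht => by linarith [(hwig.2 t ht).1]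
  have hIpos : ∀ s ∈ Ioo (0:ℝ) 1, 0 < If E q wi s := fun s hs =>
    If_pos E q hE1 hq0 wi hwic hwpos s (hIc s hs) hs.1
  refine ⟨Tf k N E q L wi, fun t => Vf k N E q L wi (clp t), Tf_deriv k N E q L wi (gc _ hwig), gc _ hwig,
    ?_, Tf_one k N E q L wi, ?_, ?_, ?_⟩
  · show Vf k N E q L wi (clp 0) = 0
    rw [clp_eq 0 (by simp), Vf_zero k N hk]
  · intro r hr
    show 0 < Vf k N E q L wi (clp r)
    rw [clp_eq r (hIc r hr)]
    have := hIpos r hr; have := hr.1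
    unfold Vf; positivity
  · have hIC : ContDiff ℝ 1 (If E q wi) := by
      rw [contDiff_one_iff_deriv]
      refine ⟨fun s => (If_deriv E q hE1 hq0 wi hwic s).differentiableAt, ?_⟩
      have : deriv (If E q wi) = fun t => t ^ (E - 1) * wi t ^ q :=
        funext fun s => (If_deriv E q hE1 hq0 wi hwic s).deriv
      rw [this]
      exact If_integrand_cont E q hE1 hq0 wi hwic
    have : ContDiffOn ℝ 1 (fun s => (L * If E q wi s / s ^ N) ^ ((1:ℝ) / k)) (Ioo 0 1) := by
      apply ContDiffOn.rpow_const_of_ne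
      · exact (contDiff_const.mul hIC).contDiffOn.div (contDiff_id.pow N).contDiffOn
          (fun s hs => pow_ne_zero _ hs.1.ne')
      · intro s hs
        have := hIpos s hs; have := hs.1
        positivity
    refine this.congr fun s hs => ?_
    rw [clp_eq s (hIc s hs)]; rfl
  · intro r hr
    have h1 := (If_deriv E q hE1 hq0 wi hwic r).const_mul L
    rw [hfix r (hIc r hr), mul_assoc]
    refine h1.congr_of_eventuallyEq ?_
    filter_upwards [Ioo_mem_nhds hr.1 hr.2] with s hs
    rw [clp_eq s (hIc s hs)]
    exact Vf_pow k N hk E q L hL wi (h0 _ hwig) s (hIc s hs) hs.1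

lemma cnk_pos (n k : ℕ) (hnk : 2 * k < n) : 0 < cnk n k := by
  unfold cnk
  have h1 : 0 < n.choose k := Nat.choose_pos (by omega)
  have h2 : 0 < n := by omega
  positivity

lemma fun_ev (n i : ℕ) (hi : i ≤ n) (v : ℝ → ℝ) (r : ℝ) (hr : 0 < r) :
    (fun s : ℝ => s ^ ((n : ℝ) - i) * v s ^ i) =ᶠ[nhds r] fun s => s ^ (n - i) * v s ^ i := by
  filter_upwards [Ioi_mem_nhds hr] with s hs
  rw [← Nat.cast_sub hi, Real.rpow_natCast]

lemma to_sol (n k : ℕ) (hk : 1 ≤ k) (hnk : 2 * k < n) (q σ lam : ℝ) (u : ℝ → ℝ)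
    (hu : IsRadialSol n k q σ lam u) :
    Sol k (n - k) q σ (lam / cnk n k) (fun r => 1 - u r) (deriv u) := by
  obtain ⟨hC2, hC1, -, hu1, hneg, hmon, heq⟩ := hu
  have hnhds : ∀ r ∈ Ioo (0:ℝ) 1, Icc (0:ℝ) 1 ∈ nhds r := fun r hr => Icc_mem_nhds hr.1 hr.2
  have hud : ∀ r ∈ Ioo (0:ℝ) 1, DifferentiableAt ℝ u r := fun r hr =>
    (hC1.differentiableOn one_ne_zero).differentiableAt (hnhds r hr)
  have hvd : ∀ r ∈ Ioo (0:ℝ) 1, DifferentiableAt ℝ (deriv u) r := by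
    have h : ContDiffOn ℝ (1 + 1) u (Ioo 0 1) := by
      have : (1 + 1 : WithTop ℕ∞) = 2 := by norm_num
      rw [this]; exact hC2
    rw [contDiffOn_succ_iff_deriv_of_isOpen isOpen_Ioo] at h
    exact fun r hr => (h.2.2.differentiableOn one_ne_zero).differentiableAt (Ioo_mem_nhds hr.1 hr.2)
  have hcd : ContinuousOn (derivWithin u (Icc 0 1)) (Icc 0 1) :=
    hC1.continuousOn_derivWithin (uniqueDiffOn_Icc zero_lt_one) le_rfl
  obtain ⟨M, hM⟩ := isCompact_Icc.exists_bound_of_continuousOn hcd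
  have hbd : ∀ r ∈ Ioo (0:ℝ) 1, |deriv u r| ≤ M := by
    intro r hr
    have := hM r ⟨hr.1.le, hr.2.le⟩
    rwa [derivWithin_of_mem_nhds (hnhds r hr), Real.norm_eq_abs] at this
  have hdp : ∀ i : ℕ, ∀ r ∈ Ioo (0:ℝ) 1, DifferentiableAt ℝ (fun s => s ^ (n - i) * deriv u s ^ i) r :=
    fun i r hr => (differentiableAt_fun_id.pow _).mul ((hvd r hr).pow _)
  have hc := cnk_pos n k hnk
  refine ⟨continuousOn_const.sub hC1.continuousOn, ?_, ?_, hvd, ?_, ⟨M, fun r hr => (le_abs_self _).trans (hbd r hr)⟩, ?_⟩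
  · have h1 : ∀ r ∈ Icc (0:ℝ) 1, u r ≤ 0 := by
      intro r hr
      have hcl : Icc (0:ℝ) 1 = closure (Ioo 0 1) := (closure_Ioo (by norm_num)).symm
      refine le_on_closure (f := u) (g := fun _ => (0:ℝ)) (s := Ioo 0 1) (fun x hx => (hneg x hx).le) ?_ continuousOn_const ?_
      · rw [← hcl]; exact hC1.continuousOn
      · rw [← hcl]; exact hr
    intro r hr
    have := h1 r hr
    show 0 < 1 - u r
    linarith
  · intro r hr
    exact (hud r hr).hasDerivAt.const_sub 1
  · have key := nonneg_of_deriv (fun s => s ^ (n - 1) * deriv u s ^ 1)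
      (fun r => deriv (fun s => s ^ (n - 1) * deriv u s ^ 1) r)
      (fun r hr => (hdp 1 r hr).hasDerivAt) ?_ ?_
    · intro r hr
      have h1 := key r hr
      have h2 : 0 < r ^ (n - 1) := pow_pos hr.1 _
      simp only [pow_one] at h1
      exact nonneg_of_mul_nonneg_right h1 h2
    · intro r hr
      have := hmon 1 le_rfl hk r hr
      rwa [(fun_ev n 1 (by omega) (deriv u) r hr.1).deriv_eq] at this
    · have h1 : Tendsto (fun s : ℝ => s ^ (n - 1) * M) (nhdsWithin 0 (Ioi 0)) (nhds 0) := by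
        have : Continuous (fun s : ℝ => s ^ (n - 1) * M) := by fun_prop
        have h := (this.tendsto 0).mono_left (nhdsWithin_le_nhds (s := Ioi (0:ℝ)))
        have hz : (0:ℝ) ^ (n - 1) = 0 := zero_pow (by omega)
        simpa only [hz, zero_mul] using h
      refine squeeze_zero_norm' ?_ h1
      filter_upwards [Ioo_mem_nhdsGT (zero_lt_one' ℝ)] with s hs
      have h2 : 0 ≤ s ^ (n - 1) := pow_nonneg hs.1.le _
      rw [pow_one, norm_mul, Real.norm_of_nonneg h2, Real.norm_eq_abs]
      exact mul_le_mul_of_nonneg_left (hbd s hs) h2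
  · intro r hr
    have hr0 := hr.1
    have h1 := heq r hr
    rw [(fun_ev n k (by omega) (deriv u) r hr.1).deriv_eq] at h1
    refine (hdp k r hr).hasDerivAt.congr_deriv ?_
    symm
    set D := deriv (fun s => s ^ (n - k) * deriv u s ^ k) r
    have hE : r ^ (((n - k : ℕ):ℝ) + k + σ - 1) = r ^ σ / r ^ (1 - (n:ℝ)) := by
      rw [← Real.rpow_sub hr0, Nat.cast_sub (by omega)]
      congr 1; ring
    have h3 : 0 < r ^ (1 - (n:ℝ)) := by positivity
    rw [hE]
    show lam / cnk n k * (r ^ σ / r ^ (1 - (n:ℝ))) * (1 - u r) ^ q = D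
    field_simp
    linarith

lemma from_sol (n k : ℕ) (hk : 1 ≤ k) (hnk : 2 * k < n) (q σ lam : ℝ) (hlam : 0 < lam) (W V : ℝ → ℝ)
    (hW : ∀ r, HasDerivAt W (-(V r)) r) (hV : Continuous V) (hV0 : V 0 = 0) (hW1 : W 1 = 1)
    (hVp : ∀ r ∈ Ioo (0:ℝ) 1, 0 < V r) (hV1 : ContDiffOn ℝ 1 V (Ioo 0 1))
    (hode : ∀ r ∈ Ioo (0:ℝ) 1, HasDerivAt (fun s => s ^ (n - k) * V s ^ k)
      (lam / cnk n k * r ^ (((n - k : ℕ):ℝ) + k + σ - 1) * W r ^ q) r) :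
    IsRadialSol n k q σ lam (fun r => 1 - W r) := by
  have hud : ∀ r, HasDerivAt (fun r => 1 - W r) (V r) r := fun r => by
    simpa using (hW r).const_sub 1
  have hdu : deriv (fun r => 1 - W r) = V := funext fun r => (hud r).deriv
  have hc := cnk_pos n k hnk
  have hWgt : ∀ r ∈ Ioo (0:ℝ) 1, 1 < W r := by
    intro r hr
    have hanti : StrictAntiOn W (Icc r 1) := by
      apply strictAntiOn_of_deriv_neg (convex_Icc _ _)
      · exact fun x _ => (hW x).continuousAt.continuousWithinAt
      · intro x hx
        rw [interior_Icc] at hx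
        rw [(hW x).deriv]
        linarith [hVp x ⟨hr.1.trans hx.1, hx.2⟩]
    have := hanti ⟨le_rfl, hr.2.le⟩ ⟨hr.2.le, le_rfl⟩ hr.2
    linarith
  have hmono : MonotoneOn (fun s => s ^ (n - k) * V s ^ k) (Ioo 0 1) := by
    apply monotoneOn_of_deriv_nonneg (convex_Ioo 0 1)
    · exact fun r hr => (hode r hr).continuousAt.continuousWithinAt
    · rw [interior_Ioo]; exact fun r hr => (hode r hr).differentiableAt.differentiableWithinAt
    · rw [interior_Ioo]; intro r hr; rw [(hode r hr).deriv]
      have := hWgt r hr; have := hr.1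
      positivity
  refine ⟨?_, ?_, ?_, ?_, ?_, ?_, ?_⟩
  · have : (2 : WithTop ℕ∞) = 1 + 1 := by norm_num
    rw [this, contDiffOn_succ_iff_deriv_of_isOpen isOpen_Ioo, hdu]
    refine ⟨fun r _ => (hud r).differentiableAt.differentiableWithinAt, by simp, hV1⟩
  · apply ContDiff.contDiffOn
    rw [contDiff_one_iff_deriv, hdu]
    exact ⟨fun r => (hud r).differentiableAt, hV⟩
  · rw [hdu]; exact hV0
  · show 1 - W 1 = 0
    rw [hW1]; ring
  · intro r hr
    have := hWgt r hr
    show 1 - W r < 0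
    linarith
  · intro i hi1 hik r hr
    rw [hdu, (fun_ev n i (by omega) V r hr.1).deriv_eq]
    have hm : MonotoneOn (fun s => s ^ (n - i) * V s ^ i) (Ioo 0 1) := by
      intro s hs t ht hst
      have h1 := hmono hs ht hst
      have hs0 := hs.1; have ht0 := ht.1
      have hvs := hVp s hs; have hvt := hVp t ht
      show s ^ (n - i) * V s ^ i ≤ t ^ (n - i) * V t ^ i
      have id : ∀ x y : ℝ, (x ^ (n - i) * y ^ i) ^ k = (x ^ (n - k) * y ^ k) ^ i * x ^ (n * (k - i)) := by
        intro x y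
        obtain ⟨j, rfl⟩ := Nat.exists_eq_add_of_le hik
        obtain ⟨m, rfl⟩ := Nat.exists_eq_add_of_le (show i + j ≤ n by omega)
        have e1 : i + j + m - i = j + m := by omega
        have e2 : i + j + m - (i + j) = m := by omega
        have e3 : i + j - i = j := by omega
        rw [e1, e2, e3, mul_pow, mul_pow, ← pow_mul, ← pow_mul, ← pow_mul, ← pow_mul,
          mul_right_comm, ← pow_add]
        congr 2 <;> ring
      have : (s ^ (n - i) * V s ^ i) ^ k ≤ (t ^ (n - i) * V t ^ i) ^ k := by
        rw [id, id]
        have h1 : s ^ (n - k) * V s ^ k ≤ t ^ (n - k) * V t ^ k := h1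
        gcongr
      exact (pow_le_pow_iff_left₀ (by positivity) (by positivity) (by omega)).1 this
    have := hm.derivWithin_nonneg (x := r)
    rwa [derivWithin_of_isOpen isOpen_Ioo hr] at this
  · intro r hr
    have hr0 := hr.1
    rw [hdu, (fun_ev n k (by omega) V r hr.1).deriv_eq, (hode r hr).deriv]
    have hE : r ^ (((n - k : ℕ):ℝ) + k + σ - 1) = r ^ σ / r ^ (1 - (n:ℝ)) := by
      rw [← Real.rpow_sub hr0, Nat.cast_sub (by omega)]
      congr 1; ring
    have h3 : 0 < r ^ (1 - (n:ℝ)) := by positivity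
    rw [hE]
    have : 1 - (1 - W r) = W r := by ring
    rw [this]
    field_simp
/-- if `n > 2k + 8 + 4σ/k` and `q ≥ q_JL(k,σ)`, then the extremal parameter
equals `λ̃(k,σ)` and for each `λ ∈ (0,λ*)` problem `(P_λ)` has exactly one classical
radial solution. -/
theorem uniqueness_above_JL (n k : ℕ) (hk : 1 ≤ k) (hnk : 2 * k < n)
    (q σ : ℝ) (hq : (k : ℝ) < q) (hσ : 0 ≤ σ)
    (hn : 2 * (k : ℝ) + 8 + 4 * σ / k < n) (hqJL : qJL n k σ ≤ q) :
    sSup {lam : ℝ | 0 < lam ∧ ∃ u : ℝ → ℝ, IsRadialSol n k q σ lam u}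
        = lamTilde n k q σ ∧
    ∀ lam : ℝ, 0 < lam → lam < lamTilde n k q σ →
      ∃ u : ℝ → ℝ, IsRadialSol n k q σ lam u ∧
        ∀ v : ℝ → ℝ, IsRadialSol n k q σ lam v → EqOn v u (Icc 0 1) := by
  have hk1 : (1:ℝ) ≤ k := by exact_mod_cast hk
  obtain ⟨hms0, θ, hθ, hJ⟩ := algebra_theta n k q σ hk1 hq hσ hn hqJL
  have hqk : 0 < q - k := by linarith
  have hτ : 0 < (2 * (k:ℝ) + σ) / (q - k) := by positivity
  have hτq : (2 * (k:ℝ) + σ) / (q - k) * (q - k) = 2 * k + σ := by field_simp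
  have hlt : lamTilde n k q σ = cnk n k * (((2 * (k:ℝ) + σ) / (q - k)) ^ k *
      ((n : ℝ) - 2 * k - (k : ℝ) * ((2 * (k : ℝ) + σ) / (q - k)))) := by
    unfold lamTilde; ring
  set τ := (2 * (k:ℝ) + σ) / (q - k) with hτdef
  set ms := (n : ℝ) - 2 * k - (k : ℝ) * τ with hmsdef
  have hms : ms = (((n - k : ℕ):ℝ) + k) - 2 * k - k * τ := by
    rw [Nat.cast_sub (by omega)]; ring
  have hN : 0 < n - k := by omega
  have hc := cnk_pos n k hnk
  have hltpos : 0 < lamTilde n k q σ := by rw [hlt]; positivity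
  have hex : ∀ lam : ℝ, 0 < lam → lam < lamTilde n k q σ → ∃ u : ℝ → ℝ, IsRadialSol n k q σ lam u := by
    intro lam h0 h1
    have hL : lam / cnk n k < τ ^ k * ms := by
      rw [div_lt_iff₀ hc]; rw [hlt] at h1; linarith
    obtain ⟨W, V, a1, a2, a3, a4, a5, a6, a7⟩ :=
      sol_exists k (n - k) hk hN q σ (lam / cnk n k) τ ms hq hσ (by positivity) hτ hτq hms hms0 hL
    exact ⟨_, from_sol n k hk hnk q σ lam h0 W V a1 a2 a3 a4 a5 a6 a7⟩
  have hub : ∀ lam : ℝ, 0 < lam → ∀ u : ℝ → ℝ, IsRadialSol n k q σ lam u → lam ≤ lamTilde n k q σ := by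
    intro lam h0 u hu
    have hs := to_sol n k hk hnk q σ lam u hu
    have := sol_bound k (n - k) hk hN q σ (lam / cnk n k) τ θ ms hq hσ (by positivity) hτ hτq hθ hms hms0 hJ
      _ _ hs (by rw [hu.2.2.2.1]; ring)
    rw [div_le_iff₀ hc] at this
    rw [hlt]; linarith
  refine ⟨?_, ?_⟩
  · apply csSup_eq_of_forall_le_of_forall_lt_exists_gt
    · exact ⟨lamTilde n k q σ / 2, by positivity, hex _ (by positivity) (by linarith)⟩
    · rintro lam ⟨h0, u, hu⟩
      exact hub lam h0 u hu
    · intro w hw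
      have h1 : max w 0 < lamTilde n k q σ := max_lt hw hltpos
      obtain ⟨x, hx1, hx2⟩ := exists_between h1
      have hx0 : 0 < x := (le_max_right w 0).trans_lt hx1
      exact ⟨x, ⟨hx0, hex x hx0 hx2⟩, (le_max_left w 0).trans_lt hx1⟩
  · intro lam h0 h1
    obtain ⟨u, hu⟩ := hex lam h0 h1
    refine ⟨u, hu, fun v hv r hr => ?_⟩
    have su := to_sol n k hk hnk q σ lam u hu
    have sv := to_sol n k hk hnk q σ lam v hv
    have hL : 0 < lam / cnk n k := by positivity
    have eu : (fun r => 1 - u r) 1 = 1 := by simp [hu.2.2.2.1]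
    have ev : (fun r => 1 - v r) 1 = 1 := by simp [hv.2.2.2.1]
    have b1 := sliding k (n - k) hk hN q σ _ τ (by linarith) hL hτ hτq _ _ _ _ su sv eu ev
      (fun r hr => (sol_barrier k (n - k) hk hN q σ _ τ θ ms hq hσ hL hτ hτq hθ hms hJ _ _ sv r hr).1) r hr
    have b2 := sliding k (n - k) hk hN q σ _ τ (by linarith) hL hτ hτq _ _ _ _ sv su ev eu
      (fun r hr => (sol_barrier k (n - k) hk hN q σ _ τ θ ms hq hσ hL hτ hτq hθ hms hJ _ _ su r hr).1) r hr
    linarith
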